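/- Main Lemma (Segre form). Let q ≥ 2, let a₁,…,a_q, m be positive integers, set n = a₁+⋯+a_q and N+1 = Π_{i=1}^q(a_i+1), and let V = ℂ^{a₁+1} ⊗ ⋯ ⊗ ℂ^{a_q+1}. Fix positive integers k and r with (n+1)k < N+1, r < N, and r+1 ≥ (n+m+1)k. Assume that for the q-factor Segre in V the general linear subspace of dimension r+1 which is tangent at k general points is tangent only at those points. Then for the (q+1)-factor Segre with dimension vector (a₁,…,a_q,m) in V ⊗ ℂ^{m+1}, the general linear subspace of dimension (m+1)(r+1) which is tangent at (m+1)k general points is tangent only at those points. -/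

import Mathlib

open scoped TensorProduct
open PiTensorProduct

noncomputable section

/-- The space of tensors `V = ℂ^{a₁+1} ⊗ ⋯ ⊗ ℂ^{a_q+1}`. -/
abbrev Ten (q : ℕ) (a : Fin q → ℕ) : Type :=
  ⨂[ℂ] i : Fin q, (Fin (a i + 1) → ℂ)

/-- Index type for the coordinates on the parameter space `W_k`. -/
abbrev WIdx (q : ℕ) (a : Fin q → ℕ) (k : ℕ) : Type :=
  Fin k × Σ j : Fin q, Fin (a j + 1)

/-- Index type for the standard (decomposable) basis of `Ten q a`. -/
abbrev BIdx (q : ℕ) (a : Fin q → ℕ) : Type := ∀ j : Fin q, Fin (a j + 1)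

/-- A tensor is decomposable if it is `v₁ ⊗ ⋯ ⊗ v_q` with all `vᵢ ≠ 0`. -/
def IsDecomposable {q : ℕ} {a : Fin q → ℕ} (t : Ten q a) : Prop :=
  ∃ v : ∀ j : Fin q, Fin (a j + 1) → ℂ, (∀ j, v j ≠ 0) ∧ t = tprod ℂ v

/-- The affine tangent space at `v₁ ⊗ ⋯ ⊗ v_q` to the cone over the Segre variety:
the span of all tensors obtained by replacing one factor of `v` by an arbitrary vector. -/
def tangent {q : ℕ} (a : Fin q → ℕ) (v : ∀ j : Fin q, Fin (a j + 1) → ℂ) :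
    Submodule ℂ (Ten q a) :=
  Submodule.span ℂ
    {x | ∃ (j : Fin q) (u : Fin (a j + 1) → ℂ), x = tprod ℂ (Function.update v j u)}

/-- The map `Φ : W_k → V` sending a `k`-tuple of factor vectors to the sum of the
corresponding decomposable tensors. -/
def Phi {q : ℕ} (a : Fin q → ℕ) {k : ℕ}
    (p : Fin k → ∀ j : Fin q, Fin (a j + 1) → ℂ) : Ten q a :=
  ∑ i, tprod ℂ (p i)

/-- Evaluation of a polynomial function on `W_k` at a parameter point. -/
def evalW {q : ℕ} {a : Fin q → ℕ} {k : ℕ}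
    (F : MvPolynomial (WIdx q a k) ℂ)
    (p : Fin k → ∀ j : Fin q, Fin (a j + 1) → ℂ) : ℂ :=
  MvPolynomial.eval (fun x => p x.1 x.2.1 x.2.2) F

/-- `k`-identifiability of the Segre product `ℙ^{a₁} × ⋯ × ℙ^{a_q}`:
there is a nonzero polynomial function `F` on `W_k` such that whenever `F(p) ≠ 0`,
the tensor `Φ(p)` has a rank-`k` decomposition, and any two rank-`k` decompositions
of `Φ(p)` agree as multisets of decomposable tensors. -/
def Identifiable (q : ℕ) (a : Fin q → ℕ) (k : ℕ) : Prop :=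
  ∃ F : MvPolynomial (WIdx q a k) ℂ,
    (∃ p, evalW F p ≠ 0) ∧
    ∀ p, evalW F p ≠ 0 →
      ((∃ t : Fin k → Ten q a, (∀ i, IsDecomposable (t i)) ∧ ∑ i, t i = Phi a p) ∧
       ∀ s t : Fin k → Ten q a,
         (∀ i, IsDecomposable (s i)) → (∀ i, IsDecomposable (t i)) →
         ∑ i, s i = Phi a p → ∑ i, t i = Phi a p →
         Finset.univ.val.map s = Finset.univ.val.map t)

/-- The standard decomposable basis vector of `Ten q a` indexed by `f`. -/
def basisVec {q : ℕ} (a : Fin q → ℕ) (f : BIdx q a) : Ten q a :=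
  tprod ℂ fun j => Pi.single (f j) 1

/-- The vector of `Ten q a` with coordinates `c` in the standard basis. -/
def fromCoords {q : ℕ} (a : Fin q → ℕ) (c : BIdx q a → ℂ) : Ten q a :=
  ∑ f : BIdx q a, c f • basisVec a f

/-- Evaluation of a polynomial function on `W_k × V^e` at a parameter point. -/
def evalWV {q : ℕ} {a : Fin q → ℕ} {k e : ℕ}
    (F : MvPolynomial (WIdx q a k ⊕ (Fin e × BIdx q a)) ℂ)
    (p : Fin k → ∀ j : Fin q, Fin (a j + 1) → ℂ)
    (c : Fin e → BIdx q a → ℂ) : ℂ :=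
  MvPolynomial.eval (Sum.elim (fun x => p x.1 x.2.1 x.2.2) (fun y => c y.1 y.2)) F

/-- `TangentGeneral q a k d` says: the general linear subspace of `V` of dimension `d`
which is tangent to the Segre at `k` general points is tangent only at those points.
Concretely, with `e = d - k(1 + Σᵢ aᵢ)`, there is a nonzero polynomial function `F` on
`W_k × V^e` such that whenever `F ≠ 0` at `(p, c)`, the space `L` spanned by the tangent
spaces at the `k` decomposable tensors determined by `p` together with the `e` extra
vectors determined by `c` has dimension exactly `d`, and any decomposable tensor whose
tangent space lies in `L` is a scalar multiple of one of the `k` given ones. -/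
def TangentGeneral (q : ℕ) (a : Fin q → ℕ) (k d : ℕ) : Prop :=
  ∃ F : MvPolynomial (WIdx q a k ⊕ (Fin (d - k * (1 + ∑ j, a j)) × BIdx q a)) ℂ,
    (∃ p c, evalWV F p c ≠ 0) ∧
    ∀ p c, evalWV F p c ≠ 0 →
      (Module.finrank ℂ
          ↥((⨆ i, tangent a (p i)) ⊔
            Submodule.span ℂ (Set.range fun m => fromCoords a (c m))) = d ∧
       ∀ w : ∀ j : Fin q, Fin (a j + 1) → ℂ, (∀ j, w j ≠ 0) →
         tangent a w ≤
           (⨆ i, tangent a (p i)) ⊔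
             Submodule.span ℂ (Set.range fun m => fromCoords a (c m)) →
         ∃ (i : Fin k) (t : ℂ), tprod ℂ w = t • tprod ℂ (p i))

set_option linter.unusedSectionVars false

namespace Segre

open MvPolynomial

section FieldTheory

variable {k K : Type*} [Field k] [Field K] [Algebra k K]

theorem formallySmooth_of_charZero [CharZero k] : Algebra.FormallySmooth k K := by
  obtain ⟨s, hs⟩ := exists_isTranscendenceBasis k K
  have : Algebra.IsAlgebraic (IntermediateField.adjoin k (Set.range ((↑) : s → K))) K :=
    hs.isAlgebraic_field
  have : CharZero (IntermediateField.adjoin k (Set.range ((↑) : s → K))) :=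
    charZero_of_injective_algebraMap (algebraMap k _).injective
  exact .of_algebraicIndependent_of_isSeparable hs.1

/-- A derivation from a subring with values in an overring which is formally smooth over it
extends to the overring. -/
theorem exists_derivation_extension {R A : Type*} [CommRing R] [CommRing A] [Algebra R A]
    [Algebra.FormallySmooth R A] (d : Derivation ℤ R A) :
    ∃ D : Derivation ℤ A A, ∀ x, D (algebraMap R A x) = d x := by
  let φ : R →+* TrivSqZeroExt A A :=
    { toFun := fun x => TrivSqZeroExt.inl (algebraMap R A x) + TrivSqZeroExt.inr (d x)
      map_one' := by simp
      map_mul' := fun x y => by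
        ext
        · simp
        · simp only [Derivation.leibniz, map_mul, TrivSqZeroExt.snd_add, TrivSqZeroExt.snd_inl,
            TrivSqZeroExt.snd_inr, TrivSqZeroExt.snd_mul, TrivSqZeroExt.fst_add,
            TrivSqZeroExt.fst_inl, TrivSqZeroExt.fst_inr, Algebra.smul_def, zero_add, add_zero,
            MulOpposite.smul_eq_mul_unop, MulOpposite.unop_op]
          simp [mul_comm]
      map_zero' := by simp
      map_add' := fun x y => by
        ext <;> simp }
  let _ : Algebra R (TrivSqZeroExt A A) := φ.toAlgebra
  let g : TrivSqZeroExt A A →ₐ[R] A :=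
    { (TrivSqZeroExt.fstHom A A A).toRingHom with
      commutes' := fun r => by
        change TrivSqZeroExt.fst (φ r) = _
        simp [φ] }
  have hg : Function.Surjective g := fun x => ⟨TrivSqZeroExt.inl x, rfl⟩
  have hker : IsNilpotent (RingHom.ker (g : TrivSqZeroExt A A →+* A)) := by
    refine ⟨2, (pow_two (RingHom.ker (g : TrivSqZeroExt A A →+* A))).trans ?_⟩
    rw [Ideal.zero_eq_bot, eq_bot_iff, Ideal.mul_le]
    intro x hx y hy
    have hx' : x.fst = 0 := hx
    have hy' : y.fst = 0 := hy
    rw [Ideal.mem_bot]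
    ext
    · simp [hx']
    · simp [hx', hy']
  let σ := Algebra.FormallySmooth.liftOfSurjective (AlgHom.id R A) g hg hker
  have hσ : ∀ x, (σ x).fst = x := fun x =>
    Algebra.FormallySmooth.liftOfSurjective_apply (AlgHom.id R A) g hg hker x
  refine ⟨Derivation.mk' (AddMonoidHom.toIntLinearMap
    { toFun := fun x => (σ x).snd
      map_zero' := by simp
      map_add' := fun x y => by simp }) ?_, ?_⟩
  · intro a b
    simp [hσ, mul_comm]
  · intro x
    change (σ (algebraMap R A x)).snd = d x
    rw [σ.commutes]
    change (φ x).snd = d x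
    simp [φ]

open scoped IntermediateField.algebraAdjoinAdjoin in
/-- Algebraically independent elements of a field extension of characteristic zero can be moved
independently by derivations. -/
theorem exists_derivation_of_algebraicIndependent [CharZero k] {ι : Type*} {θ : ι → K}
    (hθ : AlgebraicIndependent k θ) (δ : ι → K) :
    ∃ D : Derivation k K K, ∀ i, D (θ i) = δ i := by
  let _ : Algebra (MvPolynomial ι k) K := (aeval θ).toRingHom.toAlgebra
  have : IsScalarTower k (MvPolynomial ι k) K := IsScalarTower.of_algebraMap_eq fun x =>
    (AlgHom.commutes (aeval θ) x).symm
  have hsm : Algebra.FormallySmooth (MvPolynomial ι k) K := by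
    let S := Algebra.adjoin k (Set.range θ)
    let E := IntermediateField.adjoin k (Set.range θ)
    let e : MvPolynomial ι k ≃ₐ[k] S := hθ.aevalEquiv
    let _ : Algebra (MvPolynomial ι k) S := e.toRingEquiv.toRingHom.toAlgebra
    have h1 : Algebra.FormallySmooth (MvPolynomial ι k) S :=
      .of_equiv (AlgEquiv.ofRingEquiv (f := e.toRingEquiv) fun x => rfl)
    have h2 : Algebra.FormallySmooth S E := .of_isLocalization (nonZeroDivisors _)
    have : CharZero E := charZero_of_injective_algebraMap (algebraMap k _).injective
    have h3 : Algebra.FormallySmooth E K := formallySmooth_of_charZero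
    have : IsScalarTower (MvPolynomial ι k) S K := IsScalarTower.of_algebraMap_eq fun x =>
      (hθ.algebraMap_aevalEquiv x).symm
    have h4 : Algebra.FormallySmooth S K := .comp S E K
    exact .comp (MvPolynomial ι k) S K
  obtain ⟨D, hD⟩ := exists_derivation_extension
    ((mkDerivation k δ : Derivation k (MvPolynomial ι k) K).restrictScalars ℤ)
  have hDk : ∀ c, D (algebraMap k K c) = 0 := fun c => by
    rw [IsScalarTower.algebraMap_apply k (MvPolynomial ι k) K, hD]
    exact Derivation.map_algebraMap (mkDerivation k δ : Derivation k (MvPolynomial ι k) K) c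
  let Dk : K →ₗ[k] K :=
    { toFun := D
      map_add' := fun x y => by simp
      map_smul' := fun c x => by simp [Algebra.smul_def, hDk] }
  refine ⟨Derivation.mk' Dk fun a b => D.leibniz a b, fun i => ?_⟩
  · change D (θ i) = δ i
    have : θ i = algebraMap (MvPolynomial ι k) K (X i) := (aeval_X θ i).symm
    rw [this, hD]
    exact mkDerivation_X k δ i

/-- Elements which can be moved independently by derivations satisfy no polynomial equation
with constant coefficients. -/
theorem eq_zero_of_eval_eq_zero_of_derivation [CharZero K] {Z : Type*} [DecidableEq Z]
    (D : Z → Derivation k K K) (x : Z → K) (hD : ∀ i j, D i (x j) = if i = j then 1 else 0)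
    (P : MvPolynomial Z K) (hP : ∀ i m, D i (P.coeff m) = 0) (h0 : eval x P = 0) : P = 0 := by
  have key : ∀ i, ∀ Q : MvPolynomial Z K, (∀ m, D i (Q.coeff m) = 0) →
      D i (eval x Q) = eval x (pderiv i Q) := by
    intro i Q hQ
    have hmon : ∀ m : Z →₀ ℕ, D i (eval x (monomial m (1 : K))) =
        eval x (pderiv i (monomial m (1 : K))) := by
      have : ∀ R : MvPolynomial Z ℤ, D i (eval x (MvPolynomial.map (Int.castRingHom K) R)) =
          eval x (pderiv i (MvPolynomial.map (Int.castRingHom K) R)) := by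
        intro R
        induction R using MvPolynomial.induction_on with
        | C a => simp
        | add p q hp hq => simp only [map_add, hp, hq]
        | mul_X p j hp =>
          simp only [map_mul, map_X, eval_X, Derivation.leibniz, hp, pderiv_X, smul_eq_mul, hD,
            map_add]
          by_cases h : i = j <;> simp [h]
      intro m
      have := this (monomial m 1)
      simpa using this
    conv_lhs => rw [Q.as_sum]
    conv_rhs => rw [Q.as_sum]
    simp only [map_sum]
    refine Finset.sum_congr rfl fun m _ => ?_
    have : monomial m (coeff m Q) = C (coeff m Q) * monomial m 1 := by
      rw [C_mul_monomial, mul_one]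
    rw [this, pderiv_C_mul]
    simp [hQ, hmon]
  by_contra hne
  have hzero : ∀ Q : MvPolynomial Z K, eval x Q = 0 → Q.totalDegree = 0 → Q = 0 := by
    intro Q hQ0 hdeg
    rw [totalDegree_eq_zero_iff_eq_C.mp hdeg] at hQ0 ⊢
    rw [eval_C] at hQ0
    rw [hQ0, C_0]
  have : ∀ n, ∀ Q : MvPolynomial Z K, (∀ i m, D i (Q.coeff m) = 0) → eval x Q = 0 →
      Q.totalDegree ≤ n → Q = 0 := by
    intro n
    induction n with
    | zero => exact fun Q _ hQ0 hdeg => hzero Q hQ0 (Nat.le_zero.mp hdeg)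
    | succ n ih =>
      intro Q hQ hQ0 hdeg
      have hpd : ∀ i, pderiv i Q = 0 := by
        intro i
        refine ih _ ?_ ?_ ?_
        · intro j m
          rw [coeff_pderiv]
          have : ((m i : K) + 1) = ((m i + 1 : ℕ) : K) := by push_cast; ring
          rw [this]
          simp [hQ]
        · rw [← key i Q (hQ i), hQ0, map_zero]
        · refine Finset.sup_le fun m hm => ?_
          rw [mem_support_iff, coeff_pderiv] at hm
          have := le_totalDegree (mem_support_iff.mpr (left_ne_zero_of_mul hm))
          rw [Finsupp.sum_add_index' (fun _ => rfl) (fun _ _ _ => rfl),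
            Finsupp.sum_single_index rfl] at this
          omega
      refine hzero Q hQ0 (Nat.le_zero.mp (Finset.sup_le fun m hm => ?_))
      have hm0 : m = 0 := by
        ext i
        by_contra hi
        have hle : Finsupp.single i 1 ≤ m := by
          rw [Finsupp.single_le_iff]
          exact Nat.one_le_iff_ne_zero.mpr hi
        have h := coeff_pderiv (i := i) Q (m - Finsupp.single i 1)
        rw [hpd, coeff_zero, tsub_add_cancel_of_le hle] at h
        rcases mul_eq_zero.mp h.symm with h | h
        · exact mem_support_iff.mp hm h
        · exact Nat.cast_add_one_ne_zero _ h
      simp [hm0]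
  exact hne (this _ P hP h0 le_rfl)

theorem exists_algHom_of_isTranscendenceBasis {M ι : Type*} [Field M] [Algebra k M]
    [IsAlgClosed M] {x : ι → K} (hx : IsTranscendenceBasis k x) {y : ι → M}
    (hy : AlgebraicIndependent k y) : ∃ σ : K →ₐ[k] M, ∀ i, σ (x i) = y i := by
  let φ : Algebra.adjoin k (Set.range x) →ₐ[k] M := (aeval y).comp hx.1.aevalEquiv.symm.toAlgHom
  let _ : Algebra (Algebra.adjoin k (Set.range x)) M := φ.toRingHom.toAlgebra
  have : IsScalarTower k (Algebra.adjoin k (Set.range x)) M :=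
    IsScalarTower.of_algebraMap_eq fun c => (φ.commutes c).symm
  have : FaithfulSMul (Algebra.adjoin k (Set.range x)) M :=
    (faithfulSMul_iff_algebraMap_injective _ _).mpr
      (Function.Injective.comp (g := aeval y) hy hx.1.aevalEquiv.symm.injective)
  have := hx.isAlgebraic
  let σ : K →ₐ[Algebra.adjoin k (Set.range x)] M := IsAlgClosed.lift
  refine ⟨σ.restrictScalars k, fun i => ?_⟩
  have h : x i = algebraMap (Algebra.adjoin k (Set.range x)) K (hx.1.aevalEquiv (X i)) := by
    rw [hx.1.algebraMap_aevalEquiv, aeval_X]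
  rw [h, AlgHom.restrictScalars_apply, σ.commutes]
  change aeval y (hx.1.aevalEquiv.symm (hx.1.aevalEquiv (X i))) = _
  rw [AlgEquiv.symm_apply_apply, aeval_X]

/-- A transcendental element over an algebraically closed field extension can be translated by
an endomorphism. -/
theorem exists_algHom_translate [IsAlgClosed K] {t : K} (ht : Transcendental k t) (c : k) :
    ∃ σ : K →ₐ[k] K, σ t = t + algebraMap k K c := by
  classical
  have ht' : AlgebraicIndepOn k id ({t} : Set K) := by
    exact (algebraicIndependent_singleton_iff (⟨t, rfl⟩ : ({t} : Set K))).mpr ht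
  obtain ⟨s, hts, hs⟩ := exists_isTranscendenceBasis_superset ht'
  have hmem : t ∈ s := hts rfl
  let i₀ : s := ⟨t, hmem⟩
  let f : MvPolynomial s k →ₐ[k] MvPolynomial s k := aeval fun i => X i + if i = i₀ then C c else 0
  let g : MvPolynomial s k →ₐ[k] MvPolynomial s k := aeval fun i => X i - if i = i₀ then C c else 0
  have hgf : g.comp f = AlgHom.id k _ := by
    ext1 i
    by_cases h : i = i₀ <;> simp [f, g, h]
  have hf : Function.Injective f := fun a b hab => by
    simpa using (DFunLike.congr_fun hgf a).symm.trans
      ((congrArg g hab).trans (DFunLike.congr_fun hgf b))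
  have hy : AlgebraicIndependent k
      (fun i : s => (i : K) + if i = i₀ then algebraMap k K c else 0) := by
    have : (aeval fun i : s => (i : K) + if i = i₀ then algebraMap k K c else 0) =
        (aeval ((↑) : s → K)).comp f := by
      ext1 i
      by_cases h : i = i₀ <;> simp [f, h]
    rw [AlgebraicIndependent, this]
    exact Function.Injective.comp (g := aeval ((↑) : s → K)) hs.1 hf
  obtain ⟨σ, hσ⟩ := exists_algHom_of_isTranscendenceBasis hs hy
  exact ⟨σ, by simpa [i₀] using hσ i₀⟩

theorem exists_algebraicIndependent_of_countable (k : Subfield ℂ) (hk : Countable k)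
    (Z : Type*) [Finite Z] : ∃ θ : Z → ℂ, AlgebraicIndependent k θ := by
  obtain ⟨s, hs⟩ := exists_isTranscendenceBasis k ℂ
  have hinf : Infinite s := by
    by_contra hfin
    rw [not_infinite_iff_finite] at hfin
    have h1 := IsAlgClosed.cardinal_le_max_transcendence_basis' _ hs
    have h2 : Cardinal.mk s ≤ Cardinal.aleph0 := (Cardinal.mk_lt_aleph0).le
    have h3 : Cardinal.mk k ≤ Cardinal.aleph0 := Cardinal.mk_le_aleph0
    have h4 : Cardinal.mk ℂ ≤ Cardinal.aleph0 := h1.trans (by simp [h2])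
    rw [Cardinal.mk_complex] at h4
    exact absurd h4 (not_le.mpr Cardinal.aleph0_lt_continuum)
  obtain ⟨f⟩ : Nonempty (Z ↪ s) := by
    cases nonempty_fintype Z
    exact ⟨(Fintype.equivFin Z).toEmbedding.trans
      (Fin.valEmbedding.trans (Infinite.natEmbedding s))⟩
  exact ⟨fun z => f z, hs.1.comp f f.injective⟩

end FieldTheory

end Segre

namespace Segre

open Function

section Coordinates

variable {ι : Type*} [Fintype ι] [DecidableEq ι] {κ : ι → Type*} [∀ i, Fintype (κ i)]
  [∀ i, DecidableEq (κ i)]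

/-- Coordinates of tuples of factor vectors. -/
abbrev Pts (κ : ι → Type*) (R : Type*) := ∀ i, κ i → R

/-- Coordinates of tensors in the standard decomposable basis. -/
abbrev Vec (κ : ι → Type*) (R : Type*) := (∀ i, κ i) → R

section Ring

variable {R : Type*} [CommRing R]

/-- The Segre map in coordinates. -/
def seg : MultilinearMap R (fun i => κ i → R) (Vec κ R) :=
  MultilinearMap.pi fun f =>
    (MultilinearMap.mkPiAlgebra R ι R).compLinearMap fun i => LinearMap.proj (f i)

theorem seg_apply (v : Pts κ R) (f : ∀ i, κ i) : seg v f = ∏ i, v i (f i) := by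
  simp [seg]

/-- The derivative of the Segre map. -/
def dseg (v : Pts κ R) : Pts κ R →ₗ[R] Vec κ R := seg.linearDeriv v

theorem dseg_apply (v u : Pts κ R) : dseg v u = ∑ j, seg (update v j (u j)) :=
  MultilinearMap.linearDeriv_apply _ _ _

theorem seg_update_zero (v : Pts κ R) (j : ι) : seg (update v j 0) = 0 :=
  MultilinearMap.map_update_zero _ _ _

theorem dseg_single (v : Pts κ R) (j : ι) (w : κ j → R) :
    dseg v (Pi.single j w) = seg (update v j w) := by
  rw [dseg_apply, Finset.sum_eq_single j]
  · simp
  · intro i _ hi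
    rw [Pi.single_eq_of_ne hi, seg_update_zero]
  · simp

theorem seg_update_eq_sum (v : Pts κ R) (j : ι) (w : κ j → R) :
    seg (update v j w) = ∑ b, w b • seg (update v j (Pi.single b 1)) := by
  conv_lhs => rw [pi_eq_sum_univ' w]
  rw [MultilinearMap.map_update_sum]
  refine Finset.sum_congr rfl fun b _ => ?_
  rw [MultilinearMap.map_update_smul]

theorem dseg_eq_sum (v u : Pts κ R) :
    dseg v u = ∑ j, ∑ b, u j b • seg (update v j (Pi.single b 1)) := by
  rw [dseg_apply]
  exact Finset.sum_congr rfl fun j _ => seg_update_eq_sum v j (u j)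

theorem seg_single (f : ∀ i, κ i) :
    seg (fun i => Pi.single (f i) (1 : R) : Pts κ R) = Pi.single f 1 := by
  funext g
  rw [seg_apply]
  by_cases h : g = f
  · subst h; simp
  · rw [Pi.single_eq_of_ne h]
    obtain ⟨i, hi⟩ := Function.ne_iff.mp h
    exact Finset.prod_eq_zero (Finset.mem_univ i) (Pi.single_eq_of_ne hi _)

section Map

variable {R' : Type*} [CommRing R'] (φ : R →+* R')

theorem seg_map (v : Pts κ R) (f : ∀ i, κ i) :
    φ (seg v f) = seg (fun i b => φ (v i b)) f := by
  simp [seg_apply]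

theorem map_update (v : Pts κ R) (j : ι) (w : κ j → R) :
    (fun i b => φ (update v j w i b)) = update (fun i b => φ (v i b)) j fun b => φ (w b) := by
  funext i
  by_cases h : i = j
  · subst h; simp
  · simp [h]

theorem map_single {j : ι} (b : κ j) :
    (fun x => φ ((Pi.single b 1 : κ j → R) x)) = Pi.single b 1 := by
  funext x
  by_cases h : x = b
  · subst h; simp
  · simp [h]

theorem dseg_map (v u : Pts κ R) (f : ∀ i, κ i) :
    φ (dseg v u f) = dseg (fun i b => φ (v i b)) (fun i b => φ (u i b)) f := by
  simp only [dseg_apply, Finset.sum_apply, map_sum, seg_map, map_update]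

end Map

/-- The tangent space to the cone over the Segre variety. -/
def tan (v : Pts κ R) : Submodule R (Vec κ R) := LinearMap.range (dseg v)

theorem dseg_mem_tan (v u : Pts κ R) : dseg v u ∈ tan v := ⟨u, rfl⟩

theorem seg_update_mem_tan (v : Pts κ R) (j : ι) (w : κ j → R) : seg (update v j w) ∈ tan v :=
  ⟨Pi.single j w, dseg_single v j w⟩

theorem seg_mem_tan [Nonempty ι] (v : Pts κ R) : seg v ∈ tan v := by
  have j : ι := Classical.arbitrary ι
  simpa using seg_update_mem_tan v j (v j)

theorem tan_eq_span (v : Pts κ R) : tan v = Submodule.span R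
    (Set.range fun z : Σ j, κ j => seg (update v z.1 (Pi.single z.2 1))) := by
  apply le_antisymm
  · rintro _ ⟨u, rfl⟩
    rw [dseg_eq_sum]
    exact Submodule.sum_mem _ fun j _ => Submodule.sum_mem _ fun b _ =>
      Submodule.smul_mem _ _ (Submodule.subset_span ⟨⟨j, b⟩, rfl⟩)
  · rw [Submodule.span_le]
    rintro _ ⟨z, rfl⟩
    exact seg_update_mem_tan v _ _

theorem tan_le_iff {v : Pts κ R} {L : Submodule R (Vec κ R)} :
    tan v ≤ L ↔ ∀ j b, seg (update v j (Pi.single b 1)) ∈ L := by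
  rw [tan_eq_span, Submodule.span_le, Set.range_subset_iff]
  exact ⟨fun h j b => h ⟨j, b⟩, fun h z => h z.1 z.2⟩

/-- The span of tangent spaces and further vectors. -/
def Lspan {S E : Type*} (p : S → Pts κ R) (c : E → Vec κ R) : Submodule R (Vec κ R) :=
  (⨆ s, tan (p s)) ⊔ Submodule.span R (Set.range c)

section Lspan

variable {S E : Type*} (p : S → Pts κ R) (c : E → Vec κ R)

theorem tan_le_Lspan (s : S) : tan (p s) ≤ Lspan p c :=
  (le_iSup (fun s => tan (p s)) s).trans le_sup_left

theorem mem_Lspan_right (i : E) : c i ∈ Lspan p c :=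
  le_sup_right (a := ⨆ s, tan (p s)) (Submodule.subset_span ⟨i, rfl⟩)

variable {p c} in
theorem Lspan_le {L : Submodule R (Vec κ R)} :
    Lspan p c ≤ L ↔ (∀ s, tan (p s) ≤ L) ∧ ∀ i, c i ∈ L := by
  rw [Lspan, sup_le_iff, iSup_le_iff, Submodule.span_le, Set.range_subset_iff]
  rfl

variable {p c} in
theorem mem_Lspan [Fintype S] [Fintype E] {x : Vec κ R} (h : x ∈ Lspan p c) :
    ∃ (τ : S → Pts κ R) (β : E → R), x = ∑ s, dseg (p s) (τ s) + ∑ i, β i • c i := by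
  obtain ⟨y, hy, z, hz, rfl⟩ := Submodule.mem_sup.mp h
  obtain ⟨β, rfl⟩ := (Submodule.mem_span_range_iff_exists_fun R).mp hz
  have : ⨆ s, tan (p s) ≤ LinearMap.range (∑ s, dseg (p s) ∘ₗ LinearMap.proj s :
      (S → Pts κ R) →ₗ[R] Vec κ R) := by
    classical
    refine iSup_le fun s => ?_
    rintro _ ⟨u, rfl⟩
    refine ⟨Pi.single s u, ?_⟩
    rw [LinearMap.sum_apply, Finset.sum_eq_single s]
    · simp
    · intro t _ ht
      simp [ht]
    · simp
  obtain ⟨τ, rfl⟩ := this hy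
  exact ⟨τ, β, by simp⟩

end Lspan

end Ring

section Derivation

variable {k K : Type*} [Field k] [Field K] [Algebra k K] {X : Type*}

/-- A derivation acting on coordinates. -/
def dv (D : Derivation k K K) (F : X → K) : X → K := fun x => D (F x)

theorem dv_add (D : Derivation k K K) (F G : X → K) : dv D (F + G) = dv D F + dv D G := by
  funext x; simp [dv]

theorem dv_zero (D : Derivation k K K) : dv D (0 : X → K) = 0 := by
  funext x; simp [dv]

theorem dv_sum {Y : Type*} (D : Derivation k K K) (s : Finset Y) (F : Y → X → K) :
    dv D (∑ y ∈ s, F y) = ∑ y ∈ s, dv D (F y) := by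
  funext x; simp [dv]

theorem dv_smul (D : Derivation k K K) (a : K) (F : X → K) :
    dv D (a • F) = a • dv D F + D a • F := by
  funext x; simp [dv, mul_comm]

theorem dv_single [DecidableEq X] (D : Derivation k K K) (x : X) :
    dv D (Pi.single x 1) = 0 := by
  funext y
  by_cases h : y = x
  · subst h; simp [dv]
  · simp [dv, h]

theorem derivation_prod (D : Derivation k K K) (x : ι → K) :
    D (∏ i, x i) = ∑ j, ∏ i, update x j (D (x j)) i := by
  have : ∀ s : Finset ι, D (∏ i ∈ s, x i) = ∑ j ∈ s, ∏ i ∈ s, update x j (D (x j)) i := by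
    intro s
    induction s using Finset.induction_on with
    | empty => simp
    | insert a s ha ih =>
      rw [Finset.prod_insert ha, Derivation.leibniz, ih, Finset.sum_insert ha,
        Finset.prod_insert ha, add_comm]
      congr 1
      · rw [update_self, smul_eq_mul, mul_comm]
        congr 1
        exact Finset.prod_congr rfl fun i hi => by
          rw [update_of_ne (ne_of_mem_of_not_mem hi ha)]
      · rw [smul_eq_mul, Finset.mul_sum]
        refine Finset.sum_congr rfl fun j hj => ?_
        rw [Finset.prod_insert ha, update_of_ne (ne_of_mem_of_not_mem hj ha).symm]
  exact this Finset.univ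

theorem dv_seg (D : Derivation k K K) (v : Pts κ K) :
    dv D (seg v) = dseg v fun j => dv D (v j) := by
  funext f
  simp only [dv, seg_apply, dseg_apply, Finset.sum_apply, derivation_prod]
  refine Finset.sum_congr rfl fun j _ => Finset.prod_congr rfl fun i _ => ?_
  by_cases h : i = j
  · subst h; simp [dv]
  · simp [h]

theorem dv_update (D : Derivation k K K) (v : Pts κ K) (j : ι) (w : κ j → K) :
    (fun i => dv D (update v j w i)) = update (fun i => dv D (v i)) j (dv D w) := by
  funext i
  by_cases h : i = j
  · subst h; simp
  · simp [h]

/-- Stability of a subspace under coordinatewise derivation. -/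
def Stable (D : Derivation k K K) (H : Submodule K (X → K)) : Prop := ∀ F ∈ H, dv D F ∈ H

theorem stable_span {D : Derivation k K K} {T : Set (X → K)} {H : Submodule K (X → K)}
    (hH : H = Submodule.span K T) (h : ∀ F ∈ T, dv D F ∈ H) : Stable D H := by
  subst hH
  intro F hF
  induction hF using Submodule.span_induction with
  | mem F hF => exact h F hF
  | zero => rw [dv_zero]; exact Submodule.zero_mem _
  | add F G _ _ hF hG => rw [dv_add]; exact Submodule.add_mem _ hF hG
  | smul a F hF' hF =>
    rw [dv_smul]
    exact Submodule.add_mem _ (Submodule.smul_mem _ _ hF) (Submodule.smul_mem _ _ hF')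

theorem Stable.sup {D : Derivation k K K} {H H' : Submodule K (X → K)} (h : Stable D H)
    (h' : Stable D H') : Stable D (H ⊔ H') := by
  intro F hF
  obtain ⟨y, hy, z, hz, rfl⟩ := Submodule.mem_sup.mp hF
  rw [dv_add]
  exact Submodule.add_mem_sup (h y hy) (h' z hz)

theorem stable_tan {D : Derivation k K K} {v : Pts κ K} (h : ∀ j, dv D (v j) = 0) :
    Stable D (tan v) := by
  refine stable_span (tan_eq_span v) ?_
  rintro _ ⟨z, rfl⟩
  dsimp only
  rw [dv_seg, dv_update, dv_single]
  have : update (fun i => dv D (v i)) z.1 0 = 0 := by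
    funext i
    by_cases hi : i = z.1
    · subst hi; simp
    · simp [hi, h]
  rw [this, map_zero]
  exact Submodule.zero_mem _

theorem Lspan_eq_span {R S E : Type*} [CommRing R] (p : S → Pts κ R) (c : E → Vec κ R) :
    Lspan p c = Submodule.span R (Set.range (Sum.elim
      (fun z : S × Σ j, κ j => seg (update (p z.1) z.2.1 (Pi.single z.2.2 1))) c)) := by
  apply le_antisymm
  · rw [Lspan_le]
    refine ⟨fun s => tan_le_iff.mpr fun j b => Submodule.subset_span ⟨Sum.inl ⟨s, j, b⟩, rfl⟩,
      fun i => Submodule.subset_span ⟨Sum.inr i, rfl⟩⟩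
  · rw [Submodule.span_le]
    rintro _ ⟨z | i, rfl⟩
    · exact tan_le_Lspan p c z.1 (seg_update_mem_tan _ _ _)
    · exact mem_Lspan_right p c i

theorem stable_Lspan {S E : Type*} {D : Derivation k K K} {p : S → Pts κ K} {c : E → Vec κ K}
    (hp : ∀ s j, dv D (p s j) = 0) (hc : ∀ i, dv D (c i) ∈ Lspan p c) : Stable D (Lspan p c) := by
  refine stable_span (Lspan_eq_span p c) ?_
  rintro _ ⟨z | i, rfl⟩
  · exact tan_le_Lspan p c z.1 (stable_tan (hp z.1) _ (seg_update_mem_tan _ _ _))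
  · exact hc i

/-- A subspace which contains a decomposable tensor, and which is stable under derivations moving
the factors of that tensor arbitrarily, is everything. -/
theorem eq_top_of_stable {H : Submodule K (Vec κ K)} {x : Pts κ K}
    (hx : ∀ δ : Pts κ K, ∃ D : Derivation k K K, (∀ j, dv D (x j) = δ j) ∧ Stable D H)
    (h : seg x ∈ H) : H = ⊤ := by
  have key : ∀ (f : ∀ j, κ j) (T : Finset ι),
      seg (T.piecewise (fun j => Pi.single (f j) 1 : Pts κ K) x) ∈ H := by
    intro f T
    induction T using Finset.induction_on with
    | empty => simpa using h
    | insert j T hj ih =>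
      obtain ⟨D, hD, hst⟩ := hx (Pi.single j (Pi.single (f j) 1))
      have := hst _ ih
      rw [dv_seg] at this
      have hd : (fun i => dv D (T.piecewise (fun j => Pi.single (f j) 1 : Pts κ K) x i)) =
          Pi.single j (Pi.single (f j) 1) := by
        funext i
        by_cases hi : i ∈ T
        · rw [Finset.piecewise_eq_of_mem _ _ _ hi, dv_single,
            Pi.single_eq_of_ne (ne_of_mem_of_not_mem hi hj)]
        · rw [Finset.piecewise_eq_of_notMem _ _ _ hi, hD]
      rw [hd, dseg_single] at this
      rwa [Finset.piecewise_insert]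
  rw [eq_top_iff]
  intro F _
  rw [pi_eq_sum_univ' F]
  refine Submodule.sum_mem _ fun f _ => Submodule.smul_mem _ _ ?_
  have := key f Finset.univ
  rw [Finset.piecewise_univ, seg_single] at this
  exact this

end Derivation

end Coordinates

universe u

/-- Linear independence of a family of vectors is detected by a minor. -/
theorem exists_minor {I B R K₀ : Type*} [Finite I] [Finite B] [CommRing R] [Field K₀]
    (W : I → B → R) (φ₀ : R →+* K₀) (h : LinearIndependent K₀ fun i b => φ₀ (W i b)) :
    ∃ F : R, φ₀ F ≠ 0 ∧ ∀ (K : Type u) [Field K] (φ : R →+* K), φ F ≠ 0 →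
      LinearIndependent K fun i b => φ (W i b) := by
  classical
  have := Fintype.ofFinite I
  have := Fintype.ofFinite B
  set A : Matrix I B K₀ := fun i b => φ₀ (W i b) with hA
  have hrank : A.rank = Fintype.card I := LinearIndependent.rank_matrix h
  rw [Matrix.rank_eq_finrank_span_cols] at hrank
  have htop : Submodule.span K₀ (Set.range A.col) = ⊤ := by
    apply Submodule.eq_top_of_finrank_eq
    rw [hrank, Module.finrank_fintype_fun_eq_card]
  obtain ⟨κ, a, ha, hspan, hli⟩ := exists_linearIndependent' K₀ A.col
  rw [htop] at hspan
  have := Finite.of_injective a ha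
  have := Fintype.ofFinite κ
  have hcard : Fintype.card I = Fintype.card κ := by
    have := finrank_span_eq_card hli
    rw [hspan, finrank_top, Module.finrank_fintype_fun_eq_card] at this
    exact this
  let e := Fintype.equivOfCardEq hcard
  refine ⟨Matrix.det (Matrix.of fun i j => W i (a (e j))), ?_, ?_⟩
  · have h1 : LinearIndependent K₀ (Matrix.col (Matrix.of fun i j => φ₀ (W i (a (e j))))) :=
      hli.comp e e.injective
    rw [Matrix.linearIndependent_cols_iff_isUnit, Matrix.isUnit_iff_isUnit_det, isUnit_iff_ne_zero]
      at h1
    rwa [RingHom.map_det]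
  · intro K _ φ hF
    have h1 : Matrix.det (Matrix.of fun i j => φ (W i (a (e j)))) ≠ 0 := by
      rwa [RingHom.map_det] at hF
    have h2 := Matrix.linearIndependent_rows_of_det_ne_zero h1
    exact LinearIndependent.of_comp (LinearMap.funLeft K K fun j => a (e j)) h2

section Coordinates

variable {ι : Type*} [Fintype ι] [DecidableEq ι] {κ : ι → Type*} [∀ i, Fintype (κ i)]
  [∀ i, DecidableEq (κ i)] {S E : Type*}

section Frame

/-- The index type of a minimal spanning family of a span of tangent spaces and vectors. -/
abbrev FIdx (E : Type*) (b : S → ∀ j, κ j) : Type _ :=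
  (Σ s : S, Option (Σ j, {x : κ j // x ≠ b s j})) ⊕ E

/-- A minimal spanning family of a span of tangent spaces and vectors. -/
def frame {R : Type*} [CommRing R] (p : S → Pts κ R) (c : E → Vec κ R) (b : S → ∀ j, κ j) :
    FIdx E b → Vec κ R
  | .inl ⟨s, none⟩ => seg (p s)
  | .inl ⟨s, some ⟨j, x⟩⟩ => seg (update (p s) j (Pi.single x.1 1))
  | .inr i => c i

theorem frame_map {R R' : Type*} [CommRing R] [CommRing R'] (φ : R →+* R') (p : S → Pts κ R)
    (c : E → Vec κ R) (b : S → ∀ j, κ j) (z : FIdx E b) (f : ∀ j, κ j) :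
    φ (frame p c b z f) = frame (fun s j x => φ (p s j x)) (fun i f => φ (c i f)) b z f := by
  rcases z with ⟨s, _ | ⟨j, x⟩⟩ | i
  · simp only [frame, seg_map]
  · simp only [frame, seg_map, map_update, map_single]
  · rfl

/-- The expected dimension of a span of tangent spaces and vectors. -/
def fullDim (κ : ι → Type*) [∀ i, Fintype (κ i)] (S E : Type*) [Fintype S] [Fintype E] : ℕ :=
  Fintype.card S * (1 + ∑ j, (Fintype.card (κ j) - 1)) + Fintype.card E

theorem card_FIdx [Fintype S] [Fintype E] (b : S → ∀ j, κ j) :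
    Fintype.card (FIdx E b) = fullDim κ S E := by
  simp only [Fintype.card_sum, Fintype.card_sigma, Fintype.card_option, ne_eq,
    Fintype.card_subtype_compl, Fintype.card_unique, Finset.sum_const, fullDim,
    Finset.card_univ, smul_eq_mul]
  rw [add_comm 1]

variable {K : Type*} [Field K] [Nonempty ι] {p : S → Pts κ K} {c : E → Vec κ K}
  {b : S → ∀ j, κ j}

theorem span_frame (hb : ∀ s j, p s j (b s j) ≠ 0) :
    Submodule.span K (Set.range (frame p c b)) = Lspan p c := by
  apply le_antisymm
  · rw [Submodule.span_le]
    rintro _ ⟨⟨s, _ | ⟨j, x⟩⟩ | i, rfl⟩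
    · exact tan_le_Lspan p c s (seg_mem_tan _)
    · exact tan_le_Lspan p c s (seg_update_mem_tan _ _ _)
    · exact mem_Lspan_right p c i
  · rw [Lspan_le]
    refine ⟨fun s => tan_le_iff.mpr fun j x => ?_, fun i => Submodule.subset_span ⟨.inr i, rfl⟩⟩
    have hne : ∀ x, x ≠ b s j → seg (update (p s) j (Pi.single x 1)) ∈
        Submodule.span K (Set.range (frame p c b)) := fun x hx =>
      Submodule.subset_span ⟨.inl ⟨s, some ⟨j, x, hx⟩⟩, rfl⟩
    by_cases hx : x = b s j
    · subst hx
      have h0 : seg (p s) ∈ Submodule.span K (Set.range (frame p c b)) :=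
        Submodule.subset_span ⟨.inl ⟨s, none⟩, rfl⟩
      have h1 := seg_update_eq_sum (p s) j (p s j)
      rw [update_eq_self, ← Finset.add_sum_erase _ _ (Finset.mem_univ (b s j))] at h1
      rw [← sub_eq_iff_eq_add] at h1
      rw [← Submodule.smul_mem_iff _ (hb s j), ← h1]
      refine Submodule.sub_mem _ h0 (Submodule.sum_mem _ fun x hx => Submodule.smul_mem _ _ ?_)
      exact hne x (Finset.ne_of_mem_erase hx)
    · exact hne x hx

theorem finrank_Lspan_le [Fintype S] [Fintype E] (hb : ∀ s j, p s j (b s j) ≠ 0) :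
    Module.finrank K (Lspan p c) ≤ fullDim κ S E := by
  rw [← span_frame hb, ← card_FIdx b]
  exact finrank_range_le_card _

theorem linearIndependent_frame_iff [Fintype S] [Fintype E] (hb : ∀ s j, p s j (b s j) ≠ 0) :
    LinearIndependent K (frame p c b) ↔ Module.finrank K (Lspan p c) = fullDim κ S E := by
  rw [linearIndependent_iff_card_eq_finrank_span, Set.finrank, span_frame hb, card_FIdx, eq_comm]

end Frame

/-- Infinitesimal uniqueness of a tangency point. -/
def InfAt {K : Type*} [Field K] (v : Pts κ K) (L : Submodule K (Vec κ K)) : Prop :=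
  ∀ u : Pts κ K, (∀ j b, dseg (update v j (Pi.single b 1)) u ∈ L) → ∀ j, ∃ t : K, u j = t • v j

section Tangency

variable {k K : Type*} [Field k] [Field K] [Algebra k K] {p : S → Pts κ K} {c : E → Vec κ K}

theorem dv_dseg_single {D : Derivation k K K} {v : Pts κ K} {j₀ : ι} {w : κ j₀ → K}
    (h : ∀ j, dv D (v j) = Pi.single (M := fun j => κ j → K) j₀ w j) (τ : Pts κ K) :
    dv D (dseg v τ) - dseg (update v j₀ w) τ ∈ tan v := by
  rw [dseg_apply, dseg_apply, dv_sum, ← Finset.sum_sub_distrib]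
  refine Submodule.sum_mem _ fun j _ => ?_
  rw [dv_seg, dv_update, funext h]
  by_cases hj : j = j₀
  · subst hj
    rw [Pi.single, update_idem, update_idem]
    change dseg _ (Pi.single j (dv D (τ j))) - _ ∈ _
    rw [dseg_single, update_idem]
    exact Submodule.sub_mem _ (seg_update_mem_tan _ _ _) (seg_update_mem_tan _ _ _)
  · have : update (Pi.single j₀ w : Pts κ K) j (dv D (τ j)) =
        Pi.single j₀ w + Pi.single j (dv D (τ j)) := by
      funext i
      by_cases hi : i = j
      · subst hi; simp [hj]
      · simp [hi]
    rw [this, map_add, dseg_single, dseg_single, update_idem, update_comm hj, add_sub_cancel_left]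
    exact seg_update_mem_tan _ _ _

/-- Derivations move the points and vectors arbitrarily. -/
def Rich (k : Type*) {K : Type*} [Field k] [Field K] [Algebra k K] (p : S → Pts κ K)
    (c : E → Vec κ K) : Prop :=
  ∀ (δp : S → Pts κ K) (δc : E → Vec κ K), ∃ D : Derivation k K K,
    (∀ s j, dv D (p s j) = δp s j) ∧ ∀ i, dv D (c i) = δc i

theorem Rich.ne_zero (h : Rich k p c) (s : S) (j : ι) (b : κ j) : p s j b ≠ 0 := by
  obtain ⟨D, hD, -⟩ := h (fun _ _ _ => 1) 0
  intro h0
  have := congrFun (hD s j) b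
  simp [dv, h0] at this

/-- A generic span of tangent spaces is tangent only along the span of the tangency points. -/
theorem seg_mem_span_of_tan_le [Fintype S] [Fintype E] (hrich : Rich k p c)
    (hL : Lspan p c ≠ ⊤) (hinf : ∀ s, InfAt (p s) (Lspan p c)) {y : Pts κ K}
    (hy : tan y ≤ Lspan p c) (hy' : seg y ∈ Lspan p c) :
    seg y ∈ Submodule.span K (Set.range fun s => seg (p s)) := by
  classical
  obtain ⟨τ, β, hsum⟩ := mem_Lspan hy'
  have hdv : ∀ D : Derivation k K K, dv D (seg y) ∈ Lspan p c := fun D => by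
    rw [dv_seg]; exact hy (dseg_mem_tan _ _)
  have hβ : ∀ i, β i = 0 := by
    intro i
    by_contra hi
    apply hL
    rw [eq_top_iff]
    intro w _
    obtain ⟨D, hDp, hDc⟩ := hrich 0 (Pi.single i w)
    have h1 := hdv D
    rw [hsum, dv_add, dv_sum, dv_sum] at h1
    have h2 : ∑ s, dv D (dseg (p s) (τ s)) ∈ Lspan p c := Submodule.sum_mem _ fun s _ =>
      tan_le_Lspan p c s (stable_tan (hDp s) _ (dseg_mem_tan _ _))
    have h3 := (Submodule.add_mem_iff_right _ h2).mp h1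
    simp only [dv_smul, Finset.sum_add_distrib] at h3
    have h4 : ∑ i, D (β i) • c i ∈ Lspan p c := Submodule.sum_mem _ fun i _ =>
      Submodule.smul_mem _ _ (mem_Lspan_right p c i)
    have h5 := (Submodule.add_mem_iff_left _ h4).mp h3
    rw [Finset.sum_eq_single i (fun i' _ hi' => by rw [hDc, Pi.single_eq_of_ne hi', smul_zero])
      (by simp), hDc, Pi.single_eq_same] at h5
    exact (Submodule.smul_mem_iff _ hi).mp h5
  have hτ : ∀ s j, ∃ t : K, τ s j = t • p s j := by
    intro s
    apply hinf s
    intro j₀ b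
    obtain ⟨D, hDp, hDc⟩ := hrich (Pi.single s (Pi.single j₀ (Pi.single b 1))) 0
    have h1 := hdv D
    simp only [hsum, hβ, zero_smul, Finset.sum_const_zero, add_zero] at h1
    rw [dv_sum, ← Finset.add_sum_erase _ _ (Finset.mem_univ s)] at h1
    have h2 : ∑ t ∈ Finset.univ.erase s, dv D (dseg (p t) (τ t)) ∈ Lspan p c := by
      refine Submodule.sum_mem _ fun t ht => tan_le_Lspan p c t (stable_tan (fun j => ?_) _
        (dseg_mem_tan _ _))
      rw [hDp, Pi.single_eq_of_ne (Finset.ne_of_mem_erase ht)]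
      rfl
    have h3 := (Submodule.add_mem_iff_left _ h2).mp h1
    have h4 := dv_dseg_single (D := D) (v := p s) (j₀ := j₀) (w := Pi.single b 1)
      (fun j => by rw [hDp, Pi.single_eq_same]) (τ s)
    exact (Submodule.sub_mem_iff_right _ h3).mp (tan_le_Lspan p c s h4)
  choose t ht using hτ
  rw [hsum]
  simp only [hβ, zero_smul, Finset.sum_const_zero, add_zero]
  refine Submodule.sum_mem _ fun s _ => ?_
  rw [dseg_apply]
  refine Submodule.sum_mem _ fun j _ => ?_
  rw [ht, MultilinearMap.map_update_smul, update_eq_self]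
  exact Submodule.smul_mem _ _ (Submodule.subset_span ⟨s, rfl⟩)

/-- Decomposable tensors in the span of generic decomposable tensors. -/
theorem exists_eq_smul_of_mem_span [Fintype S] {b : ∀ j, κ j}
    [∀ j, Nontrivial (κ j)] (hb : ∀ s j, p s j (b j) ≠ 0)
    (hli : LinearIndependent K (frame p c fun _ => b)) {y : Pts κ K} (hy : ∀ j, y j ≠ 0)
    (h : seg y ∈ Submodule.span K (Set.range fun s => seg (p s))) :
    ∃ (s : S) (t : K), seg y = t • seg (p s) := by
  obtain ⟨α, hα⟩ := (Submodule.mem_span_range_iff_exists_fun K).mp h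
  have hy0 : seg y ≠ 0 := by
    choose f hf using fun j => Function.ne_iff.mp (hy j)
    intro h0
    have := congrFun h0 f
    rw [seg_apply, Pi.zero_apply, Finset.prod_eq_zero_iff] at this
    obtain ⟨j, -, hj⟩ := this
    exact hf j hj
  obtain ⟨s, hs⟩ : ∃ s, α s ≠ 0 := by
    by_contra! h0
    apply hy0
    rw [← hα]
    simp [h0]
  have key : ∀ j x x', α s * (y j x' * p s j x - y j x * p s j x') = 0 := by
    intro j x x'
    obtain ⟨z, hz⟩ := exists_ne (b j)
    have hli' : LinearIndependent K fun s => seg (update (p s) j (Pi.single z 1)) :=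
      hli.comp (fun s => .inl ⟨s, some ⟨j, z, hz⟩⟩) fun s t hst => by
        simpa using congrArg (Sum.elim (fun w => some w.1) fun _ => none) hst
    refine Fintype.linearIndependent_iff.mp hli' (fun s => α s * (y j x' * p s j x - y j x * p s j x')) ?_ s
    funext f
    have e1 : ∀ (v : Pts κ K) (w : κ j → K), seg (update v j w) f =
        w (f j) * ∏ i ∈ Finset.univ.erase j, v i (f i) := by
      intro v w
      rw [seg_apply, ← Finset.mul_prod_erase _ _ (Finset.mem_univ j), update_self]
      congr 1
      exact Finset.prod_congr rfl fun i hi => by rw [update_of_ne (Finset.ne_of_mem_erase hi)]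
    have e2 : ∀ (v : Pts κ K) (x : κ j), seg v (update f j x) =
        v j x * ∏ i ∈ Finset.univ.erase j, v i (f i) := by
      intro v x
      rw [seg_apply, ← Finset.mul_prod_erase _ _ (Finset.mem_univ j), update_self]
      congr 1
      exact Finset.prod_congr rfl fun i hi => by rw [update_of_ne (Finset.ne_of_mem_erase hi)]
    have e3 : ∀ x, y j x * ∏ i ∈ Finset.univ.erase j, y i (f i) =
        ∑ s, α s * (p s j x * ∏ i ∈ Finset.univ.erase j, p s i (f i)) := by
      intro x
      rw [← e2, ← hα, Finset.sum_apply]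
      simp [e2]
    simp only [Finset.sum_apply, Pi.smul_apply, e1, smul_eq_mul, Pi.zero_apply]
    have e4 : ∀ s, α s * (y j x' * p s j x - y j x * p s j x') *
        ((Pi.single z 1 : κ j → K) (f j) * ∏ i ∈ Finset.univ.erase j, p s i (f i)) =
        (Pi.single z 1 : κ j → K) (f j) * (y j x' *
          (α s * (p s j x * ∏ i ∈ Finset.univ.erase j, p s i (f i))) - y j x *
          (α s * (p s j x' * ∏ i ∈ Finset.univ.erase j, p s i (f i)))) := fun s => by ring
    simp only [e4, ← Finset.mul_sum, Finset.sum_sub_distrib, ← e3]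
    ring
  have hprop : ∀ j, y j = (y j (b j) / p s j (b j)) • p s j := by
    intro j
    funext x
    have := (mul_eq_zero.mp (key j x (b j))).resolve_left hs
    have h0 := hb s j
    simp only [Pi.smul_apply, smul_eq_mul]
    field_simp
    linear_combination -this
  refine ⟨s, ∏ j, (y j (b j) / p s j (b j)), ?_⟩
  rw [← MultilinearMap.map_smul_univ]
  congr 1
  funext j
  exact hprop j

end Tangency

end Coordinates

section Constants

variable {k K : Type*} [Field k] [Field K] [Algebra k K]

/-- The field of constants of a derivation. -/
def constants (D : Derivation k K K) : Subfield K where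
  carrier := {a | D a = 0}
  mul_mem' {a b} ha hb := by simp_all
  one_mem' := D.map_one_eq_zero
  add_mem' {a b} ha hb := by simp_all
  zero_mem' := D.map_zero
  neg_mem' {a} ha := by simp_all
  inv_mem' a ha := by
    change D a⁻¹ = 0
    rw [D.leibniz_inv, show D a = 0 from ha, smul_zero]

theorem mem_constants {D : Derivation k K K} {a : K} : a ∈ constants D ↔ D a = 0 := Iff.rfl

/-- A derivation is linear over its field of constants. -/
def overConstants (D : Derivation k K K) : Derivation (constants D) K K :=
  Derivation.mk' 
    { toFun := D
      map_add' := D.map_add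
      map_smul' := fun a x => by
        have : D (a : K) = 0 := a.2
        simp [Subfield.smul_def, this] }
    fun a b => by simp

theorem transcendental_constants [CharZero K] {D : Derivation k K K} {t : K} (ht : D t ≠ 0) :
    Transcendental (constants D) t := by
  intro halg
  have hinteg : IsIntegral (constants D) t := halg.isIntegral
  have hsep : (minpoly (constants D) t).Separable := (minpoly.irreducible hinteg).separable
  have h1 := (overConstants D).map_aeval (minpoly (constants D) t) t
  rw [minpoly.aeval, map_zero, eq_comm, smul_eq_mul, mul_eq_zero] at h1
  rcases h1 with h1 | h1
  · exact hsep.aeval_derivative_ne_zero (minpoly.aeval _ t) h1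
  · exact ht h1

/-- A subspace stable under a derivation is spanned by vectors with constant coordinates. -/
theorem Stable.eq_span {X : Type*} [Finite X] {D : Derivation k K K} {L : Submodule K (X → K)}
    (h : Stable D L) : L = Submodule.span K {F | F ∈ L ∧ dv D F = 0} := by
  classical
  have := Fintype.ofFinite X
  apply le_antisymm _ (Submodule.span_le.mpr fun F hF => hF.1)
  let e : X → (X → K) := fun x => Pi.single x 1
  obtain ⟨J, a, ha, hspan, hli⟩ := exists_linearIndependent' K fun x => L.mkQ (e x)
  have := Finite.of_injective a ha
  have := Fintype.ofFinite J
  have hzero : ∀ g : J → K, ∑ j, g j • e (a j) ∈ L → ∀ j, g j = 0 := by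
    intro g hg
    apply Fintype.linearIndependent_iff.mp hli g
    rw [← (Submodule.Quotient.mk_eq_zero L), ← Submodule.mkQ_apply, map_sum] at hg
    simpa using hg
  have hex : ∀ x, ∃ g : J → K, e x - ∑ j, g j • e (a j) ∈ L := by
    intro x
    have hx : L.mkQ (e x) ∈ Submodule.span K (Set.range ((fun x => L.mkQ (e x)) ∘ a)) := by
      rw [hspan]; exact Submodule.subset_span ⟨x, rfl⟩
    obtain ⟨g, hg⟩ := (Submodule.mem_span_range_iff_exists_fun K).mp hx
    refine ⟨g, ?_⟩
    rw [← (Submodule.Quotient.mk_eq_zero L), ← Submodule.mkQ_apply, map_sub, map_sum, ← hg]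
    simp
  choose g hg using hex
  have hconst : ∀ x, dv D (e x - ∑ j, g x j • e (a j)) = 0 := by
    intro x
    have h1 : dv D (e x - ∑ j, g x j • e (a j)) = ∑ j, (-D (g x j)) • e (a j) := by
      rw [sub_eq_add_neg, ← Finset.sum_neg_distrib, dv_add, dv_sum, dv_single, zero_add]
      refine Finset.sum_congr rfl fun j _ => ?_
      rw [← neg_smul, dv_smul, dv_single, smul_zero, zero_add, map_neg]
    have h2 := h _ (hg x)
    rw [h1] at h2 ⊢
    simp [hzero _ h2]
  intro F hF
  have h1 : F = ∑ x, F x • (e x - ∑ j, g x j • e (a j)) + ∑ j, (∑ x, F x * g x j) • e (a j) := by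
    conv_lhs => rw [pi_eq_sum_univ' F]
    simp only [smul_sub, Finset.sum_sub_distrib, Finset.sum_smul, Finset.smul_sum, smul_smul]
    rw [Finset.sum_comm (s := (Finset.univ : Finset J)), sub_add_cancel]
  have h2 : ∑ x, F x • (e x - ∑ j, g x j • e (a j)) ∈ L :=
    Submodule.sum_mem _ fun x _ => Submodule.smul_mem _ _ (hg x)
  have h3 : ∑ j, (∑ x, F x * g x j) • e (a j) ∈ L := by
    rw [h1] at hF
    exact (Submodule.add_mem_iff_right _ h2).mp hF
  have h4 := hzero _ h3
  rw [h1]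
  simp only [h4, zero_smul, Finset.sum_const_zero, add_zero]
  exact Submodule.sum_mem _ fun x _ => Submodule.smul_mem _ _
    (Submodule.subset_span ⟨hg x, hconst x⟩)

theorem Stable.map_mem {X : Type*} [Finite X] {D : Derivation k K K} {L : Submodule K (X → K)}
    (h : Stable D L) (σ : K →ₐ[constants D] K) {F : X → K} (hF : F ∈ L) :
    (fun x => σ (F x)) ∈ L := by
  have hF' := hF
  rw [h.eq_span] at hF'
  clear hF
  induction hF' using Submodule.span_induction with
  | mem F hF' =>
    have : (fun x => σ (F x)) = F := by
      funext x
      exact σ.commutes ⟨F x, congrFun hF'.2 x⟩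
    rw [this]
    exact hF'.1
  | zero =>
    have : (fun x => σ ((0 : X → K) x)) = 0 := by funext x; simp
    rw [this]
    exact L.zero_mem
  | add F G _ _ hF hG =>
    have : (fun x => σ ((F + G) x)) = (fun x => σ (F x)) + fun x => σ (G x) := by
      funext x; simp
    rw [this]
    exact L.add_mem hF hG
  | smul a F _ hF =>
    have : (fun x => σ ((a • F) x)) = σ a • fun x => σ (F x) := by
      funext x; simp
    rw [this]
    exact L.smul_mem _ hF

end Constants

section Coordinates

variable {ι : Type*} [Fintype ι] [DecidableEq ι] {κ : ι → Type*} [∀ i, Fintype (κ i)]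
  [∀ i, DecidableEq (κ i)] {S E : Type*} {k K : Type*} [Field k] [Field K] [Algebra k K]

theorem stable_Lspan_of_moving {D : Derivation k K K} {p : S → Pts κ K} {c : E → Vec κ K} {s₀ : S}
    (hp : ∀ s, s ≠ s₀ → ∀ j, dv D (p s j) = 0) (hc : ∀ i, dv D (c i) = 0)
    (h : ∀ j b, dseg (update (p s₀) j (Pi.single b 1)) (fun j => dv D (p s₀ j)) ∈ Lspan p c) :
    Stable D (Lspan p c) := by
  refine stable_span (Lspan_eq_span p c) ?_
  rintro _ ⟨⟨s, j, b⟩ | i, rfl⟩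
  · by_cases hs : s = s₀
    · subst hs
      dsimp only [Sum.elim_inl]
      rw [dv_seg, dv_update, dv_single]
      have : update (fun i => dv D (p s i)) j 0 =
          (fun i => dv D (p s i)) - Pi.single j (dv D (p s j)) := by
        funext i
        by_cases hi : i = j
        · subst hi; simp
        · simp [hi]
      rw [this, map_sub, dseg_single, update_idem]
      exact Submodule.sub_mem _ (h j b) (tan_le_Lspan p c s (seg_update_mem_tan _ _ _))
    · exact tan_le_Lspan p c s (stable_tan (hp s hs) _ (seg_update_mem_tan _ _ _))
  · dsimp only [Sum.elim_inr]
    rw [hc]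
    exact Submodule.zero_mem _

theorem mul_eq_mul_of_seg_eq_smul {v w : Pts κ K} (hw : ∀ j b, w j b ≠ 0)
    {t : K} (h : seg w = t • seg v) (f : ∀ j, κ j) (j : ι) (b b' : κ j) :
    w j b * v j b' = w j b' * v j b := by
  have e2 : ∀ (v : Pts κ K) (x : κ j), seg v (update f j x) =
      v j x * ∏ i ∈ Finset.univ.erase j, v i (f i) := by
    intro v x
    rw [seg_apply, ← Finset.mul_prod_erase _ _ (Finset.mem_univ j), update_self]
    congr 1
    exact Finset.prod_congr rfl fun i hi => by rw [update_of_ne (Finset.ne_of_mem_erase hi)]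
  have h1 := congrFun h (update f j b)
  have h2 := congrFun h (update f j b')
  rw [Pi.smul_apply, e2, e2, smul_eq_mul] at h1 h2
  have h3 : ∏ i ∈ Finset.univ.erase j, w i (f i) ≠ 0 :=
    Finset.prod_ne_zero_iff.mpr fun i _ => hw _ _
  apply mul_right_cancel₀ h3
  linear_combination v j b' * h1 - v j b * h2

/-- Uniqueness of tangency points implies infinitesimal uniqueness. -/
theorem infAt_of_unique [CharZero K] [IsAlgClosed K] [Finite S] {p : S → Pts κ K}
    {c : E → Vec κ K}
    (hrich : Rich k p c) (huniq : ∀ w : Pts κ K, (∀ j, w j ≠ 0) → tan w ≤ Lspan p c →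
      ∃ (s : S) (t : K), seg w = t • seg (p s)) (f : ∀ j, κ j) (s : S) :
    InfAt (p s) (Lspan p c) := by
  classical
  intro u hu j
  by_contra! hj
  obtain ⟨b, hb⟩ := Function.ne_iff.mp (hj (u j (f j) / p s j (f j)))
  have hne := hrich.ne_zero
  obtain ⟨D, hDp, hDc⟩ := hrich (Pi.single s u) 0
  have hDs : (fun j => dv D (p s j)) = u := by funext j; rw [hDp, Pi.single_eq_same]
  have hst : Stable D (Lspan p c) := by
    refine stable_Lspan_of_moving (s₀ := s) (fun s' hs' j => ?_) hDc ?_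
    · rw [hDp, Pi.single_eq_of_ne hs']; rfl
    · rwa [hDs]
  set t := p s j b / p s j (f j) with ht
  have hDt : D t ≠ 0 := by
    intro h0
    have h1 : p s j b = t * p s j (f j) := by rw [ht, div_mul_cancel₀ _ (hne s j _)]
    have h2 : D (p s j b) = u j b := congrFun (congrFun hDs j) b
    have h3 : D (p s j (f j)) = u j (f j) := congrFun (congrFun hDs j) (f j)
    rw [h1, D.leibniz, h0, h3, smul_zero, add_zero, smul_eq_mul] at h2
    apply hb
    rw [← h2, ht, Pi.smul_apply, smul_eq_mul]
    ring
  have htr := transcendental_constants hDt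
  obtain ⟨n, hn⟩ : ∃ n : ℕ, ∀ s', t + (n : K) ≠ p s' j b / p s' j (f j) := by
    by_contra! hcon
    choose g hg using hcon
    refine not_injective_infinite_finite g fun m n hmn => ?_
    have := (hg m).trans ((congrArg (fun s' => p s' j b / p s' j (f j)) hmn).trans (hg n).symm)
    exact_mod_cast add_left_cancel this
  obtain ⟨σ, hσ⟩ := exists_algHom_translate htr (n : constants D)
  have hσ' : σ t = t + (n : K) := by simpa using hσ
  have hσne : ∀ j b, σ (p s j b) ≠ 0 := fun j b => by
    rw [Ne, map_eq_zero]; exact hne s j b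
  obtain ⟨s', t', h'⟩ := huniq (fun j b => σ (p s j b)) (fun j => Function.ne_iff.mpr
    ⟨f j, hσne _ _⟩) (tan_le_iff.mpr fun i x => by
      have h1 := hst.map_mem σ (tan_le_Lspan p c s (seg_update_mem_tan _ i (Pi.single x 1)))
      convert h1 using 1
      funext g
      have := seg_map (σ : K →+* K) (update (p s) i (Pi.single x 1)) g
      rw [map_update, map_single] at this
      exact this.symm)
  have h1 := mul_eq_mul_of_seg_eq_smul hσne h' f j b (f j)
  apply hn s'
  rw [← hσ', ht, map_div₀, div_eq_div_iff (hσne _ _) (hne _ _ _), h1]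
  ring

end Coordinates

section Coordinates

variable {ι : Type*} [Fintype ι] [DecidableEq ι] {κ : ι → Type*} [∀ i, Fintype (κ i)]
  [∀ i, DecidableEq (κ i)] {S E : Type*} {k K : Type*} [Field k] [Field K] [Algebra k K]

theorem add_dv {X : Type*} (D D' : Derivation k K K) (F : X → K) :
    dv (D + D') F = dv D F + dv D' F := rfl

theorem dv_seg_update_single {D : Derivation k K K} {v : Pts κ K} (h : ∀ j, dv D (v j) = 0)
    (j : ι) (b : κ j) : dv D (seg (update v j (Pi.single b 1))) = 0 := by
  rw [dv_seg, dv_update, dv_single, show update (fun i => dv D (v i)) j 0 = 0 by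
    rw [funext h]; exact update_eq_self _ _, map_zero]

/-- A subspace with constant generators which is transverse to some tangent space is transverse to
the tangent space at a generic point. -/
theorem span_sup_tan_eq_top [CharZero K] {I : Type*} [Finite I] (W : I → Vec κ K) {x y : Pts κ K}
    (hx : ∀ δ : Pts κ K, ∃ D : Derivation k K K, (∀ j, dv D (x j) = δ j) ∧ ∀ g, dv D (W g) = 0)
    (hy : Submodule.span K (Set.range W) ⊔ tan y = ⊤) :
    Submodule.span K (Set.range W) ⊔ tan x = ⊤ := by
  choose D hD hDW using fun z : Σ j, κ j => hx (Pi.single z.1 (Pi.single z.2 1))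
  let C : Subfield K := ⨅ z, constants (D z)
  have hWC : ∀ g f, W g f ∈ C := fun g f =>
    Subfield.mem_iInf.mpr fun z => mem_constants.mpr (congrFun (hDW z g) f)
  let X : Pts κ (MvPolynomial (Σ j, κ j) C) := fun j b => MvPolynomial.X ⟨j, b⟩
  let W' : I ⊕ (Σ j, κ j) → Vec κ (MvPolynomial (Σ j, κ j) C) := Sum.elim
    (fun g f => MvPolynomial.C ⟨W g f, hWC g f⟩)
    fun z => seg (update X z.1 (Pi.single z.2 1))
  let ev : Pts κ K → MvPolynomial (Σ j, κ j) C →+* K := fun y =>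
    (MvPolynomial.aeval fun z : Σ j, κ j => y z.1 z.2).toRingHom
  have hev : ∀ y, (fun g f => ev y (W' g f)) = Sum.elim W
      (fun z : Σ j, κ j => seg (update y z.1 (Pi.single z.2 1))) := by
    intro y
    funext g f
    rcases g with g | z
    · simp only [ev, W', Sum.elim_inl, AlgHom.toRingHom_eq_coe, RingHom.coe_coe,
        MvPolynomial.aeval_C]
      rfl
    · simp only [W', Sum.elim_inr]
      rw [seg_map, map_update, map_single]
      simp [ev, X]
  have hsp : ∀ y, Submodule.span K (Set.range fun g f => ev y (W' g f)) =
      Submodule.span K (Set.range W) ⊔ tan y := by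
    intro y
    rw [hev, Set.Sum.elim_range, Submodule.span_union, tan_eq_span]
  rw [← hsp] at hy ⊢
  obtain ⟨J, a, ha, hspan, hli⟩ := exists_linearIndependent' K fun g f => ev y (W' g f)
  rw [hy] at hspan
  have := Finite.of_injective a ha
  have := Fintype.ofFinite J
  obtain ⟨F, hF, hmin⟩ := exists_minor (fun g => W' (a g)) (ev y) hli
  have hFx : ev x F ≠ 0 := by
    intro h0
    have h1 : MvPolynomial.map (algebraMap C K) F = 0 := by
      refine eq_zero_of_eval_eq_zero_of_derivation D (fun z => x z.1 z.2) ?_ _ ?_ ?_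
      · intro z z'
        have h2 : D z (x z'.1 z'.2) = _ := congrFun (hD z z'.1) z'.2
        rw [h2]
        obtain ⟨j, b⟩ := z
        obtain ⟨j', b'⟩ := z'
        by_cases hj : j' = j
        · subst hj
          by_cases hb : b' = b
          · subst hb; simp
          · simp [hb, Ne.symm hb]
        · have : (⟨j, b⟩ : Σ j, κ j) ≠ ⟨j', b'⟩ := fun h => hj (congrArg Sigma.fst h).symm
          simp [hj, this]
      · intro z m
        rw [MvPolynomial.coeff_map]
        exact Subfield.mem_iInf.mp (F.coeff m).2 z
      · rw [MvPolynomial.eval_map]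
        exact h0
    have h2 : F = 0 := MvPolynomial.map_injective _ (algebraMap C K).injective
      (h1.trans (map_zero _).symm)
    rw [h2, map_zero] at hF
    exact hF rfl
  have hlix := hmin K (ev x) hFx
  have hcard : Fintype.card J = Module.finrank K (Vec κ K) := by
    have := finrank_span_eq_card hli
    rw [hspan, finrank_top] at this
    exact this.symm
  have htop := hlix.span_eq_top_of_card_eq_finrank' hcard
  rw [eq_top_iff, ← htop]
  refine Submodule.span_mono ?_
  rintro _ ⟨g, rfl⟩
  exact ⟨a g, rfl⟩

theorem Lspan_eq_sup (p : S → Pts κ K) (z : E → Vec κ K) (i : E) :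
    Lspan p z = Lspan p (fun i' : {i' // i' ≠ i} => z i') ⊔ Submodule.span K {z i} := by
  apply le_antisymm
  · refine Lspan_le.mpr ⟨fun s => (tan_le_Lspan _ _ s).trans le_sup_left, fun i' => ?_⟩
    by_cases hi : i' = i
    · subst hi
      exact Submodule.mem_sup_right (Submodule.mem_span_singleton_self _)
    · exact Submodule.mem_sup_left (mem_Lspan_right p (fun i' : {i' // i' ≠ i} => z i') ⟨i', hi⟩)
  · refine sup_le (Lspan_le.mpr ⟨fun s => tan_le_Lspan _ _ s, fun i' => mem_Lspan_right _ _ _⟩) ?_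
    rw [Submodule.span_singleton_le_iff_mem]
    exact mem_Lspan_right _ _ _

theorem fullDim_eq_add_one [Fintype S] [Fintype E] [DecidableEq E] (i : E) :
    fullDim κ S E = fullDim κ S {i' // i' ≠ i} + 1 := by
  have : 0 < Fintype.card E := Fintype.card_pos_iff.mpr ⟨i⟩
  simp only [fullDim, Fintype.card_subtype_compl, Fintype.card_unique, ne_eq]
  omega

/-- Derivations move the points, some further points, and the vectors arbitrarily. -/
def RichOn (k : Type*) {K : Type*} [Field k] [Field K] [Algebra k K] (A : Finset E)
    (p : S → Pts κ K) (x : E → Pts κ K) (c : E → Vec κ K) : Prop :=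
  ∀ (δp : S → Pts κ K) (δx : E → Pts κ K) (δc : E → Vec κ K), ∃ D : Derivation k K K,
    (∀ s j, dv D (p s j) = δp s j) ∧ (∀ i ∈ A, ∀ j, dv D (x i j) = δx i j) ∧
      ∀ i, dv D (c i) = δc i

variable [DecidableEq E]

/-- Some of the vectors are replaced by decomposable tensors. -/
def mix (A : Finset E) (x : E → Pts κ K) (c : E → Vec κ K) (i : E) : Vec κ K :=
  if i ∈ A then seg (x i) else c i

theorem RichOn.rich {A : Finset E} {p : S → Pts κ K} {x : E → Pts κ K} {c : E → Vec κ K}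
    (h : RichOn k A p x c) : Rich k p c := fun δp δc => by
  obtain ⟨D, h1, -, h2⟩ := h δp 0 δc
  exact ⟨D, h1, h2⟩

/-- A derivation moving one of the further points only. -/
theorem RichOn.exists_moving {A : Finset E} {p : S → Pts κ K} {x : E → Pts κ K} {c : E → Vec κ K}
    (h : RichOn k A p x c) {i : E} (hi : i ∈ A) (δ : Pts κ K) :
    ∃ D : Derivation k K K, (∀ j, dv D (x i j) = δ j) ∧ (∀ s j, dv D (p s j) = 0) ∧
      (∀ i' ≠ i, dv D (mix A x c i') = 0) := by
  obtain ⟨D, h1, h2, h3⟩ := h 0 (Pi.single i δ) 0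
  refine ⟨D, fun j => by rw [h2 i hi, Pi.single_eq_same], h1, fun i' hi' => ?_⟩
  unfold mix
  split_ifs with hA
  · rw [dv_seg]
    have : (fun j => dv D (x i' j)) = 0 := by
      funext j
      rw [h2 i' hA, Pi.single_eq_of_ne hi']
    rw [this, map_zero]
  · exact h3 i'

theorem RichOn.not_tan_le {A : Finset E} {p : S → Pts κ K} {x : E → Pts κ K} {c : E → Vec κ K}
    (h : RichOn k A p x c) {i : E} (hi : i ∈ A) (hL : Lspan p (mix A x c) ≠ ⊤) :
    ¬ tan (x i) ≤ Lspan p (mix A x c) := by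
  intro hle
  have hmi : mix A x c i = seg (x i) := if_pos hi
  refine hL (eq_top_of_stable (k := k) (x := x i) (fun δ => ?_)
    (hmi ▸ mem_Lspan_right p (mix A x c) i))
  obtain ⟨D, h1, h2, h3⟩ := h.exists_moving hi δ
  refine ⟨D, h1, stable_Lspan h2 fun i' => ?_⟩
  by_cases hi' : i' = i
  · subst hi'
    rw [hmi, dv_seg]
    exact hle (dseg_mem_tan _ _)
  · rw [h3 i' hi']
    exact Submodule.zero_mem _

/-- Expected dimension and infinitesimal uniqueness of the tangency points. -/
def Good [Fintype S] [Fintype E] (p : S → Pts κ K) (z : E → Vec κ K) : Prop :=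
  Module.finrank K (Lspan p z) = fullDim κ S E ∧ ∀ s, InfAt (p s) (Lspan p z)

theorem mix_insert_self (A : Finset E) (x : E → Pts κ K) (c : E → Vec κ K) (i : E) :
    mix (insert i A) x c i = seg (x i) :=
  if_pos (Finset.mem_insert_self _ _)

theorem mix_insert_of_ne (A : Finset E) (x : E → Pts κ K) (c : E → Vec κ K) {i i' : E}
    (h : i' ≠ i) : mix (insert i A) x c i' = mix A x c i' := by
  simp [mix, h]

theorem mix_update_self {A : Finset E} (x : E → Pts κ K) (c : E → Vec κ K) {i : E} (hi : i ∉ A)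
    (v : Vec κ K) : mix A x (update c i v) i = v := by
  simp [mix, hi]

theorem mix_update_of_ne (A : Finset E) (x : E → Pts κ K) (c : E → Vec κ K) {i i' : E}
    (h : i' ≠ i) (v : Vec κ K) : mix A x (update c i v) i' = mix A x c i' := by
  simp [mix, h]

theorem RichOn.of_insert {A : Finset E} {i : E} {p : S → Pts κ K} {x : E → Pts κ K}
    {c : E → Vec κ K} (h : RichOn k (insert i A) p x c) : RichOn k A p x c := by
  intro δp δx δc
  obtain ⟨D, h1, h2, h3⟩ := h δp δx δc
  exact ⟨D, h1, fun i' hi' => h2 i' (Finset.mem_insert_of_mem hi'), h3⟩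

/-- If the tangent space at a further point is transverse to the span of the other generators, the
corresponding decomposable tensor can be replaced by a generic vector with the same span. -/
theorem RichOn.exists_replace [Finite S] [Finite E] {A : Finset E} {i : E} (hi : i ∉ A)
    {p : S → Pts κ K} {x : E → Pts κ K} {c : E → Vec κ K} (h : RichOn k (insert i A) p x c)
    (htop : Lspan p (fun i' : {i' // i' ≠ i} => mix A x c i') ⊔ tan (x i) = ⊤) :
    ∃ v, RichOn k A p x (update c i v) ∧
      v - seg (x i) ∈ Lspan p (fun i' : {i' // i' ≠ i} => mix A x c i') := by
  set L' := Lspan p (fun i' : {i' // i' ≠ i} => mix A x c i') with hL'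
  set gen := Sum.elim
      (fun z : S × Σ j, κ j => seg (update (p z.1) z.2.1 (Pi.single z.2.2 1)))
      (fun i' : {i' // i' ≠ i} => mix A x c i') with hgen
  have hspan' : L' = Submodule.span K (Set.range gen) := Lspan_eq_span _ _
  obtain ⟨J, a, ha, hspan, hli⟩ := exists_linearIndependent' K gen
  rw [← hspan'] at hspan
  have := Finite.of_injective a ha
  have := Fintype.ofFinite J
  have hcard : Fintype.card J ≤ Fintype.card (∀ j, κ j) := by
    simpa using hli.fintype_card_le_finrank
  obtain ⟨φ⟩ := Function.Embedding.nonempty_of_card_le hcard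
  have hmem : ∀ g : J → K, ∑ y, g y • gen (a y) ∈ L' := fun g => Submodule.sum_mem _ fun y _ =>
    Submodule.smul_mem _ _ (hspan' ▸ Submodule.subset_span ⟨a y, rfl⟩)
  refine ⟨seg (x i) + ∑ y, c i (φ y) • gen (a y), ?_, by simpa using hmem _⟩
  intro δp δx δc
  obtain ⟨D₀, h1, h2, h3⟩ := h δp (update δx i 0) δc
  obtain ⟨l, hl, w, ⟨ξ, rfl⟩, hlw⟩ := Submodule.mem_sup.mp (show δc i -
    dv D₀ (seg (x i) + ∑ y, c i (φ y) • gen (a y)) ∈ L' ⊔ tan (x i) from htop ▸ Submodule.mem_top)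
  rw [← hspan] at hl
  obtain ⟨γ, hγ⟩ := (Submodule.mem_span_range_iff_exists_fun K).mp hl
  obtain ⟨D₁, h1', h2', h3'⟩ := h 0 (Pi.single i ξ)
    (Pi.single i fun f => if hf : ∃ y, φ y = f then γ hf.choose else 0)
  have hx0 : ∀ i' ∈ A, ∀ j, dv D₁ (x i' j) = 0 := fun i' hi' j => by
    rw [h2' i' (Finset.mem_insert_of_mem hi'),
      Pi.single_eq_of_ne (ne_of_mem_of_not_mem hi' hi)]
    rfl
  have hgen0 : ∀ g, dv D₁ (gen g) = 0 := by
    rintro (⟨s, j, b⟩ | ⟨i', hi'⟩)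
    · simp only [hgen, Sum.elim_inl]
      exact dv_seg_update_single (h1' s) j b
    · simp only [hgen, Sum.elim_inr]
      unfold mix
      split_ifs with hA
      · rw [dv_seg, funext (hx0 i' hA)]
        exact map_zero _
      · rw [h3', Pi.single_eq_of_ne hi']
  have hD₁c : ∀ y, D₁ (c i (φ y)) = γ y := by
    intro y
    have := congrFun (h3' i) (φ y)
    rw [Pi.single_eq_same] at this
    change D₁ (c i (φ y)) = _ at this
    rw [this]
    have hex : ∃ y', φ y' = φ y := ⟨y, rfl⟩
    rw [dif_pos hex]
    exact congrArg γ (φ.injective hex.choose_spec)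
  have hD₁v : dv D₁ (seg (x i) + ∑ y, c i (φ y) • gen (a y)) =
      δc i - dv D₀ (seg (x i) + ∑ y, c i (φ y) • gen (a y)) := by
    rw [dv_add, dv_sum, dv_seg, ← hlw, ← hγ, add_comm]
    congr 1
    · refine Finset.sum_congr rfl fun y _ => ?_
      rw [dv_smul, hgen0, smul_zero, zero_add, hD₁c]
      rfl
    · congr 1
      funext j
      rw [h2' i (Finset.mem_insert_self _ _), Pi.single_eq_same]
  refine ⟨D₀ + D₁, fun s j => ?_, fun i' hi' j => ?_, fun i' => ?_⟩
  · rw [add_dv, h1, h1']; exact add_zero _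
  · rw [add_dv, h2 i' (Finset.mem_insert_of_mem hi'), hx0 i' hi',
      update_of_ne (ne_of_mem_of_not_mem hi' hi), add_zero]
  · by_cases hii : i' = i
    · subst hii
      rw [update_self, add_dv, hD₁v]
      abel
    · rw [update_of_ne hii, add_dv, h3, h3', Pi.single_eq_of_ne hii, add_zero]

theorem good_mix_insert [CharZero K] [Fintype S] [Fintype E] [Nonempty ι] (f : ∀ j, κ j)
    (hd : fullDim κ S E < Fintype.card (∀ j, κ j)) {A : Finset E} {i : E} (hi : i ∉ A)
    (ih : ∀ (p : S → Pts κ K) (x : E → Pts κ K) (c : E → Vec κ K), RichOn k A p x c →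
      Good p (mix A x c))
    {p : S → Pts κ K} {x : E → Pts κ K} {c : E → Vec κ K} (h : RichOn k (insert i A) p x c) :
    Good p (mix (insert i A) x c) := by
  obtain ⟨hfin, hinf⟩ := ih p x c h.of_insert
  have hne := h.rich.ne_zero
  have hsup := Lspan_eq_sup p (mix A x c) i
  have hsup' : Lspan p (mix (insert i A) x c) =
      Lspan p (fun i' : {i' // i' ≠ i} => mix A x c i') ⊔ Submodule.span K {seg (x i)} := by
    rw [Lspan_eq_sup p (mix (insert i A) x c) i, mix_insert_self]
    congr 2
    funext i'
    exact mix_insert_of_ne A x c i'.2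
  set L' := Lspan p (fun i' : {i' // i' ≠ i} => mix A x c i') with hL'
  have hle : Module.finrank K L' ≤ fullDim κ S {i' // i' ≠ i} :=
    finrank_Lspan_le (b := fun _ => f) fun s j => hne s j _
  have hfull := fullDim_eq_add_one (κ := κ) (S := S) i
  have hlt : Module.finrank K L' < Module.finrank K (Vec κ K) := by
    rw [Module.finrank_fintype_fun_eq_card]; omega
  have hmove : ∀ (y : Pts κ K), (∀ D : Derivation k K K, (∀ s j, dv D (p s j) = 0) →
      ∀ j, dv D (y j) = 0) → seg (x i) ∈ L' ⊔ tan y → L' ⊔ tan y = ⊤ := by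
    intro y hy hmem
    refine eq_top_of_stable (k := k) (x := x i) (fun δ => ?_) hmem
    obtain ⟨D, h1, h2, h3⟩ := h.exists_moving (Finset.mem_insert_self i A) δ
    refine ⟨D, h1, (stable_Lspan h2 fun i' => ?_).sup (stable_tan (hy D h2))⟩
    rw [← mix_insert_of_ne A x c i'.2, h3 _ i'.2]
    exact Submodule.zero_mem _
  have hnot : seg (x i) ∉ L' := by
    intro hmem
    have h0 : L' = ⊤ := by
      refine eq_top_of_stable (k := k) (x := x i) (fun δ => ?_) hmem
      obtain ⟨D, h1, h2, h3⟩ := h.exists_moving (Finset.mem_insert_self i A) δ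
      refine ⟨D, h1, stable_Lspan h2 fun i' => ?_⟩
      rw [← mix_insert_of_ne A x c i'.2, h3 _ i'.2]
      exact Submodule.zero_mem _
    rw [h0, finrank_top] at hlt
    exact hlt.false
  refine ⟨?_, fun s => ?_⟩
  · rw [hsup', Submodule.finrank_sup_span_singleton hnot]
    by_cases hc : mix A x c i ∈ L'
    · rw [hsup, sup_eq_left.mpr ((Submodule.span_singleton_le_iff_mem _ _).mpr hc)] at hfin
      omega
    · rw [hsup, Submodule.finrank_sup_span_singleton hc] at hfin
      exact hfin
  · intro u hu
    by_cases hall : ∀ j b, dseg (update (p s) j (Pi.single b 1)) u ∈ L'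
    · exact hinf s u fun j b => hsup ▸ Submodule.mem_sup_left (hall j b)
    push Not at hall
    obtain ⟨j, b, hjb⟩ := hall
    have hxi : seg (x i) ∈ L' ⊔ tan (update (p s) j (Pi.single b 1)) := by
      have h1 := hu j b
      rw [hsup'] at h1
      obtain ⟨l, hl, w, hw, hlw⟩ := Submodule.mem_sup.mp h1
      obtain ⟨t, rfl⟩ := Submodule.mem_span_singleton.mp hw
      have ht : t ≠ 0 := by
        rintro rfl
        rw [zero_smul, add_zero] at hlw
        exact hjb (hlw ▸ hl)
      rw [← Submodule.smul_mem_iff _ ht, show t • seg (x i) =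
        -l + dseg (update (p s) j (Pi.single b 1)) u by rw [← hlw]; abel]
      exact Submodule.add_mem_sup (Submodule.neg_mem _ hl) (dseg_mem_tan _ _)
    have htop := hmove _ (fun D hD j' => by
      rw [congrFun (dv_update D (p s) j (Pi.single b 1)) j', dv_single, funext (hD s)]
      simp) hxi
    have htop' : L' ⊔ tan (x i) = ⊤ := by
      rw [hL', Lspan_eq_span] at htop ⊢
      refine span_sup_tan_eq_top (k := k) _ (fun δ => ?_) htop
      obtain ⟨D, h1, h2, h3⟩ := h.exists_moving (Finset.mem_insert_self i A) δ
      refine ⟨D, h1, ?_⟩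
      rintro (⟨s, j, b⟩ | ⟨i', hi'⟩)
      · simp only [Sum.elim_inl]
        exact dv_seg_update_single (h2 s) j b
      · simp only [Sum.elim_inr]
        rw [← mix_insert_of_ne A x c hi', h3 _ hi']
    obtain ⟨v, hv, hvx⟩ := h.exists_replace hi htop'
    have hL : Lspan p (mix A x (update c i v)) = Lspan p (mix (insert i A) x c) := by
      rw [hsup', Lspan_eq_sup p (mix A x (update c i v)) i, mix_update_self x c hi]
      have : (fun i' : {i' // i' ≠ i} => mix A x (update c i v) i') = 
          fun i' : {i' // i' ≠ i} => mix A x c i' := by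
        funext i'
        exact mix_update_of_ne A x c i'.2 v
      rw [this]
      apply le_antisymm
      · refine sup_le le_sup_left ?_
        rw [Submodule.span_singleton_le_iff_mem, ← sub_add_cancel v (seg (x i))]
        exact Submodule.add_mem_sup hvx (Submodule.mem_span_singleton_self _)
      · refine sup_le le_sup_left ?_
        rw [Submodule.span_singleton_le_iff_mem, ← sub_sub_cancel v (seg (x i)),
          sub_eq_neg_add]
        exact Submodule.add_mem_sup (Submodule.neg_mem _ hvx)
          (Submodule.mem_span_singleton_self _)
    exact (ih p x _ hv).2 s u (hL ▸ hu)

/-- Generic vectors may be specialized to generic decomposable tensors. -/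
theorem good_mix [CharZero K] [Fintype S] [Fintype E] [Nonempty ι] (f : ∀ j, κ j)
    (hd : fullDim κ S E < Fintype.card (∀ j, κ j))
    (hgood : ∀ (p : S → Pts κ K) (c : E → Vec κ K), Rich k p c → Good p c) (A : Finset E)
    {p : S → Pts κ K} {x : E → Pts κ K} {c : E → Vec κ K} (h : RichOn k A p x c) :
    Good p (mix A x c) := by
  induction A using Finset.induction_on generalizing p x c with
  | empty =>
    have : mix ∅ x c = c := by funext i; simp [mix]
    rw [this]
    exact hgood p c h.rich
  | insert i A hi ih => exact good_mix_insert f hd hi (fun p x c h => ih h) h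

end Coordinates

section Extension

variable {q : ℕ} {κ : Fin (q + 1) → Type} [∀ i, Fintype (κ i)] [∀ i, DecidableEq (κ i)]

/-- The coordinate sets without the last factor. -/
abbrev Ini (κ : Fin (q + 1) → Type) (j : Fin q) : Type := κ j.castSucc

/-- The coordinate set of the last factor. -/
abbrev Last (κ : Fin (q + 1) → Type) : Type := κ (Fin.last q)

variable {R : Type*} [CommRing R]

/-- Adding a factor. -/
def cons (z : Last κ → R) (v : Pts (Ini κ) R) : Pts κ R :=
  Fin.snoc (α := fun j => κ j → R) v z

/-- Adding a coordinate. -/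
def consIdx (i : Last κ) (f : ∀ j, Ini κ j) : ∀ o, κ o := Fin.snoc (α := κ) f i

/-- The last factor. -/
def head (w : Pts κ R) : Last κ → R := w (Fin.last q)

/-- The other factors. -/
def tail (w : Pts κ R) : Pts (Ini κ) R := fun j => w j.castSucc

theorem cons_last (z : Last κ → R) (v : Pts (Ini κ) R) : cons z v (Fin.last q) = z :=
  Fin.snoc_last (α := fun j => κ j → R) _ _

theorem cons_castSucc (z : Last κ → R) (v : Pts (Ini κ) R) (j : Fin q) :
    cons z v j.castSucc = v j :=
  Fin.snoc_castSucc (α := fun j => κ j → R) _ _ _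

theorem consIdx_last (i : Last κ) (f : ∀ j, Ini κ j) : consIdx i f (Fin.last q) = i :=
  Fin.snoc_last (α := κ) _ _

theorem consIdx_castSucc (i : Last κ) (f : ∀ j, Ini κ j) (j : Fin q) :
    consIdx i f j.castSucc = f j :=
  Fin.snoc_castSucc (α := κ) _ _ _

theorem consIdx_eta (f : ∀ o, κ o) :
    consIdx (f (Fin.last q)) (fun j : Fin q => f j.castSucc) = f :=
  Fin.snoc_init_self (α := κ) f

theorem cons_head_tail (w : Pts κ R) : cons (head w) (tail w) = w :=
  Fin.snoc_init_self (α := fun j => κ j → R) w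

theorem update_cons_last (z ζ : Last κ → R) (v : Pts (Ini κ) R) :
    update (cons z v) (Fin.last q) ζ = cons ζ v :=
  Fin.update_snoc_last (α := fun j => κ j → R) _ _ _

theorem update_cons_castSucc (z : Last κ → R) (v : Pts (Ini κ) R) (j : Fin q)
    (w : Ini κ j → R) :
    update (cons z v) j.castSucc w = cons z (update v j w) :=
  (Fin.snoc_update (α := fun j => κ j → R) _ _ _ _).symm

/-- Slices of a tensor along the last factor. -/
def slice (i : Last κ) : Vec κ R →ₗ[R] Vec (Ini κ) R := LinearMap.funLeft R R (consIdx i)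

theorem slice_apply (i : Last κ) (F : Vec κ R) (f : ∀ j, Ini κ j) :
    slice i F f = F (consIdx i f) := rfl

/-- The tensor with a single nonzero slice. -/
def emb (i : Last κ) : Vec (Ini κ) R →ₗ[R] Vec κ R :=
  LinearMap.pi fun f => (Pi.single i 1 : Last κ → R) (f (Fin.last q)) • LinearMap.proj fun j : Fin q => f j.castSucc

theorem emb_apply (i : Last κ) (F : Vec (Ini κ) R) (f : ∀ o, κ o) :
    emb i F f = (Pi.single i 1 : Last κ → R) (f (Fin.last q)) * F fun j : Fin q => f j.castSucc := rfl

theorem seg_cons_apply (z : Last κ → R) (v : Pts (Ini κ) R) (f : ∀ o, κ o) :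
    seg (cons z v) f = z (f (Fin.last q)) * seg v fun j : Fin q => f j.castSucc := by
  rw [seg_apply, Fin.prod_univ_castSucc, seg_apply, mul_comm, cons_last]
  simp only [cons_castSucc]

theorem slice_seg (i : Last κ) (z : Last κ → R) (v : Pts (Ini κ) R) :
    slice i (seg (cons z v)) = z i • seg v := by
  funext f
  rw [slice_apply, seg_cons_apply, consIdx_last]
  simp only [consIdx_castSucc]
  rfl

theorem slice_dseg (i : Last κ) (z ζ : Last κ → R) (v u : Pts (Ini κ) R) :
    slice i (dseg (cons z v) (cons ζ u)) = ζ i • seg v + z i • dseg v u := by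
  rw [dseg_apply, Fin.sum_univ_castSucc, map_add, map_sum, add_comm]
  congr 1
  · rw [cons_last, update_cons_last, slice_seg]
  · rw [dseg_apply, Finset.smul_sum]
    refine Finset.sum_congr rfl fun j _ => ?_
    rw [cons_castSucc, update_cons_castSucc, slice_seg]

theorem emb_seg (i : Last κ) (v : Pts (Ini κ) R) : emb i (seg v) = seg (cons (Pi.single i 1) v) := by
  funext f
  rw [emb_apply, seg_cons_apply]

theorem slice_emb (i l : Last κ) (F : Vec (Ini κ) R) :
    slice i (emb l F) = (Pi.single l 1 : Last κ → R) i • F := by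
  funext f
  rw [slice_apply, emb_apply, consIdx_last]
  simp only [consIdx_castSucc]
  rfl

theorem sum_emb_slice (F : Vec κ R) : ∑ i, emb i (slice i F) = F := by
  funext f
  rw [Finset.sum_apply, Finset.sum_eq_single (f (Fin.last q))]
  · rw [emb_apply, Pi.single_eq_same, one_mul, slice_apply]
    exact congrArg F (consIdx_eta f)
  · intro i _ hi
    rw [emb_apply, Pi.single_eq_of_ne hi.symm, zero_mul]
  · simp

section Special

variable {k K : Type*} [Field k] [Field K] [Algebra k K] {T G : Type}

/-- Index type of the extra vectors in a slice. -/
abbrev SIdx (T G : Type) {N : Type} (i : N) : Type := ({l : N // l ≠ i} × T) ⊕ G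

/-- The tangency points in the slices. -/
def specialPts (x : Last κ × T → Pts (Ini κ) K) (z : Last κ × T) : Pts κ K :=
  cons (Pi.single z.1 1) (x z)

/-- The extra vectors in the slices. -/
def specialVec (c : Last κ → (Last κ × T) ⊕ G → Vec (Ini κ) K) (z : Last κ × G) : Vec κ K :=
  emb z.1 (c z.1 (.inr z.2))

/-- The extra vectors of a single slice. -/
def sliceVec (x : Last κ × T → Pts (Ini κ) K) (c : Last κ → (Last κ × T) ⊕ G → Vec (Ini κ) K) (i : Last κ) :
    SIdx T G i → Vec (Ini κ) K :=
  Sum.elim (fun z => seg (x (z.1, z.2))) fun g => c i (.inr g)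

/-- The span belonging to a single slice. -/
def sliceSpan (x : Last κ × T → Pts (Ini κ) K) (c : Last κ → (Last κ × T) ⊕ G → Vec (Ini κ) K) (i : Last κ) :
    Submodule K (Vec (Ini κ) K) :=
  Lspan (fun s => x (i, s)) (sliceVec x c i)

theorem mem_Lspan_special [NeZero q] (x : Last κ × T → Pts (Ini κ) K) (c : Last κ → (Last κ × T) ⊕ G → Vec (Ini κ) K)
    (F : Vec κ K) : F ∈ Lspan (specialPts x) (specialVec c) ↔
      ∀ i, slice i F ∈ sliceSpan x c i := by
  constructor
  · intro hF i
    have hle : Lspan (specialPts x) (specialVec c) ≤ (sliceSpan x c i).comap (slice i) := by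
      refine Lspan_le.mpr ⟨?_, ?_⟩
      · rintro ⟨l, s⟩ _ ⟨w, rfl⟩
        rw [Submodule.mem_comap, ← cons_head_tail w, specialPts, slice_dseg]
        by_cases hl : l = i
        · subst hl
          exact tan_le_Lspan (fun s => x (l, s)) _ s (Submodule.add_mem _
            (Submodule.smul_mem _ _ (seg_mem_tan _)) (Submodule.smul_mem _ _ (dseg_mem_tan _ _)))
        · rw [Pi.single_eq_of_ne (Ne.symm hl), zero_smul, add_zero]
          exact Submodule.smul_mem _ _ (mem_Lspan_right _ (sliceVec x c i) (.inl (⟨l, hl⟩, s)))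
      · rintro ⟨l, g⟩
        rw [Submodule.mem_comap, specialVec, slice_emb]
        by_cases hl : l = i
        · subst hl
          exact Submodule.smul_mem _ _ (mem_Lspan_right _ (sliceVec x c l) (.inr g))
        · rw [Pi.single_eq_of_ne (Ne.symm hl), zero_smul]
          exact Submodule.zero_mem _
    exact hle hF
  · intro h
    rw [← sum_emb_slice F]
    refine Submodule.sum_mem _ fun i _ => ?_
    have hle : sliceSpan x c i ≤ (Lspan (specialPts x) (specialVec c)).comap (emb i) := by
      refine Lspan_le.mpr ⟨fun s => tan_le_iff.mpr fun j b => ?_, ?_⟩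
      · rw [Submodule.mem_comap, emb_seg, ← update_cons_castSucc]
        exact tan_le_Lspan (specialPts x) _ (i, s) (seg_update_mem_tan _ _ _)
      · rintro (⟨⟨l, hl⟩, s⟩ | g)
        · rw [Submodule.mem_comap, sliceVec, Sum.elim_inl, emb_seg,
            ← update_cons_last (Pi.single l 1)]
          exact tan_le_Lspan (specialPts x) _ (l, s) (seg_update_mem_tan _ _ _)
        · exact mem_Lspan_right _ (specialVec c) (i, g)
    exact hle (h i)

theorem slice_glue (H : Last κ → Vec (Ini κ) R) (i : Last κ) :
    slice i (fun f => H (f (Fin.last q)) fun j : Fin q => f j.castSucc) = H i := by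
  funext f
  rw [slice_apply]
  simp only [consIdx_last, consIdx_castSucc]

/-- The span of the special configuration is the product of the spans of the slices. -/
def specialEquiv [NeZero q] (x : Last κ × T → Pts (Ini κ) K) (c : Last κ → (Last κ × T) ⊕ G → Vec (Ini κ) K) :
    Lspan (specialPts x) (specialVec c) ≃ₗ[K] ∀ i, sliceSpan x c i where
  toFun F i := ⟨slice i F.1, (mem_Lspan_special x c F.1).mp F.2 i⟩
  map_add' F F' := by
    funext i
    exact Subtype.ext (map_add _ _ _)
  map_smul' a F := by
    funext i
    exact Subtype.ext (map_smul _ _ _)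
  invFun H := ⟨fun f => (H (f (Fin.last q))).1 fun j : Fin q => f j.castSucc,
    (mem_Lspan_special x c _).mpr fun i =>
      (congrArg (· ∈ sliceSpan x c i) (slice_glue (fun i => (H i).1) i)).mpr (H i).2⟩
  left_inv F := by
    apply Subtype.ext
    funext f
    exact congrArg F.1 (consIdx_eta f)
  right_inv H := by
    funext i
    exact Subtype.ext (slice_glue (fun i => (H i).1) i)

theorem fullDim_special [Fintype T] [Fintype G] :
    fullDim κ (Last κ × T) (Last κ × G) = ∑ i : Last κ, fullDim (Ini κ) T (SIdx T G i) := by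
  have h : ∀ i : Last κ, fullDim (Ini κ) T (SIdx T G i) = Fintype.card T * (1 + ∑ j, (Fintype.card (Ini κ j) - 1))
      + ((Fintype.card (Last κ) - 1) * Fintype.card T + Fintype.card G) := by
    intro i
    simp [fullDim, Fintype.card_subtype_compl]
  have h' : ∑ o, (Fintype.card (κ o) - 1) =
      (Fintype.card (Last κ) - 1) + ∑ j, (Fintype.card (Ini κ j) - 1) := by
    rw [Fin.sum_univ_castSucc, add_comm]
  rw [Finset.sum_congr rfl fun i _ => h i, Finset.sum_const, Finset.card_univ, smul_eq_mul,
    fullDim, h', Fintype.card_prod, Fintype.card_prod]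
  ring

variable [Fintype T] [DecidableEq T] [Fintype G] [DecidableEq G]

/-- A configuration concentrated in the slices is good. -/
theorem good_special [CharZero K] [NeZero q] (f : ∀ j, Ini κ j)
    (hd : ∀ i : Last κ, fullDim (Ini κ) T (SIdx T G i) < Fintype.card (∀ j, Ini κ j))
    (hgood : ∀ (i : Last κ) (p : T → Pts (Ini κ) K) (c : SIdx T G i → Vec (Ini κ) K), Rich k p c → Good p c)
    {x : Last κ × T → Pts (Ini κ) K} {c : Last κ → (Last κ × T) ⊕ G → Vec (Ini κ) K}
    (hrich : Rich k x fun z : Last κ × ((Last κ × T) ⊕ G) => c z.1 z.2) :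
    Good (specialPts x) (specialVec c) := by
  let A : ∀ i : Last κ, Finset (SIdx T G i) := fun i => Finset.univ.image Sum.inl
  let x' : ∀ i : Last κ, SIdx T G i → Pts (Ini κ) K := fun i =>
    Sum.elim (fun z => x (z.1, z.2)) 0
  let c' : ∀ i : Last κ, SIdx T G i → Vec (Ini κ) K := fun i =>
    Sum.elim (fun z => c i (.inl (z.1, z.2))) fun g => c i (.inr g)
  have hrichOn : ∀ i, RichOn k (A i) (fun s => x (i, s)) (x' i) (c' i) := by
    intro i δp δx δc
    obtain ⟨D, h1, h2⟩ := hrich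
      (fun z => if h : z.1 = i then δp z.2 else δx (.inl (⟨z.1, h⟩, z.2)))
      (fun z => if z.1 = i then
        Sum.elim (fun y : Last κ × T => if h : y.1 = i then 0 else δc (.inl (⟨y.1, h⟩, y.2)))
          (fun g => δc (.inr g)) z.2 else 0)
    refine ⟨D, fun s j => ?_, fun y hy j => ?_, fun y => ?_⟩
    · rw [h1]; simp
    · obtain ⟨⟨⟨l, hl⟩, s⟩, -, rfl⟩ := Finset.mem_image.mp hy
      simp only [x', Sum.elim_inl]
      rw [h1]
      simp [hl]
    · rcases y with ⟨⟨l, hl⟩, s⟩ | g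
      · simp only [c', Sum.elim_inl]
        rw [h2 (i, .inl (l, s))]
        simp [hl]
      · simp only [c', Sum.elim_inr]
        rw [h2 (i, .inr g)]
        simp
  have hmix : ∀ i, mix (A i) (x' i) (c' i) = sliceVec x c i := by
    intro i
    funext y
    rcases y with z | g <;> simp [mix, A, x', c', sliceVec]
  have hg : ∀ i, Good (fun s => x (i, s)) (sliceVec x c i) := fun i => by
    rw [← hmix]
    exact good_mix f (hd i) (hgood i) (A i) (hrichOn i)
  have hne : ∀ i, sliceSpan x c i ≠ ⊤ := by
    intro i h
    have := (hg i).1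
    rw [← sliceSpan, h, finrank_top, Module.finrank_fintype_fun_eq_card] at this
    exact (hd i).ne this.symm
  refine ⟨?_, ?_⟩
  · rw [(specialEquiv x c).finrank_eq, Module.finrank_pi_fintype, fullDim_special]
    exact Finset.sum_congr rfl fun i _ => (hg i).1
  · rintro ⟨l, s⟩ w hw
    have key : ∀ i j b, head w i • seg (update (x (l, s)) j (Pi.single b 1)) +
        (Pi.single l 1 : Last κ → K) i • dseg (update (x (l, s)) j (Pi.single b 1)) (tail w) ∈
          sliceSpan x c i := by
      intro i j b
      have h1 := (mem_Lspan_special x c _).mp (hw j.castSucc b) i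
      rw [specialPts, update_cons_castSucc, ← cons_head_tail w, slice_dseg] at h1
      exact h1
    have hzero : ∀ i, i ≠ l → head w i = 0 := by
      intro i hi
      by_contra h0
      have h1 : tan (x (l, s)) ≤ sliceSpan x c i := by
        refine tan_le_iff.mpr fun j b => ?_
        have := key i j b
        rw [Pi.single_eq_of_ne hi, zero_smul, add_zero] at this
        exact (Submodule.smul_mem_iff _ h0).mp this
      have h2 := (hrichOn i).not_tan_le (i := .inl (⟨l, hi.symm⟩, s)) (by simp [A])
        (by rw [hmix]; exact hne i)
      rw [hmix] at h2
      exact h2 h1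
    have htail : ∀ j, ∃ t : K, tail w j = t • x (l, s) j := by
      refine (hg l).2 s (tail w) fun j b => ?_
      have h1 := key l j b
      rw [Pi.single_eq_same, one_smul] at h1
      exact (Submodule.add_mem_iff_right _ (Submodule.smul_mem _ _ (tan_le_Lspan (fun s => x (l, s))
        (sliceVec x c l) s (seg_update_mem_tan _ _ _)))).mp h1
    refine Fin.lastCases ⟨head w l, ?_⟩ fun j => ?_
    · funext i
      rw [specialPts, cons_last]
      change head w i = head w l * (Pi.single l 1 : Last κ → K) i
      by_cases hi : i = l
      · subst hi; simp
      · rw [hzero i hi, Pi.single_eq_of_ne hi, mul_zero]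
    · rw [specialPts, cons_castSucc]
      exact htail j

end Special

end Extension

section Spread

variable {ι : Type} [Fintype ι] [DecidableEq ι] {κ : ι → Type} [∀ i, Fintype (κ i)]
  [∀ i, DecidableEq (κ i)] {S E : Type} [Fintype S] [Fintype E]

/-- A family whose independence expresses infinitesimal uniqueness of a tangency point. -/
def infFam {R : Type*} [CommRing R] (p : S → Pts κ R) (c : E → Vec κ R) (b : S → ∀ j, κ j)
    (s : S) : ((Σ j, κ j) × FIdx E b) ⊕ (Σ j, {x : κ j // x ≠ b s j}) →
      (Σ j, κ j) × (∀ j, κ j) → R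
  | .inl i, y => if i.1 = y.1 then frame p c b i.2 y.2 else 0
  | .inr x, y => dseg (update (p s) y.1.1 (Pi.single y.1.2 1))
      (Pi.single x.1 (Pi.single x.2.1 1)) y.2

theorem infFam_map {R R' : Type*} [CommRing R] [CommRing R'] (φ : R →+* R') (p : S → Pts κ R)
    (c : E → Vec κ R) (b : S → ∀ j, κ j) (s : S)
    (i : ((Σ j, κ j) × FIdx E b) ⊕ (Σ j, {x : κ j // x ≠ b s j}))
    (y : (Σ j, κ j) × (∀ j, κ j)) :
    φ (infFam p c b s i y) =
      infFam (fun s j x => φ (p s j x)) (fun i f => φ (c i f)) b s i y := by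
  rcases i with i | x
  · by_cases h : i.1 = y.1
    · simp only [infFam, if_pos h, frame_map]
    · simp only [infFam, if_neg h, map_zero]
  · simp only [infFam, dseg_single, seg_map, map_update, map_single]

section Field

variable {K : Type*} [Field K] [Nonempty ι] {p : S → Pts κ K} {c : E → Vec κ K}
  {b : S → ∀ j, κ j}

/-- Extension by zero of the coordinates different from a base coordinate. -/
def extendZero {b : ∀ j, κ j} (μ : (Σ j, {x : κ j // x ≠ b j}) → K) : Pts κ K :=
  fun j x => if h : x ≠ b j then μ ⟨j, x, h⟩ else 0

theorem extendZero_eq_sum {b : ∀ j, κ j} (μ : (Σ j, {x : κ j // x ≠ b j}) → K) :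
    extendZero μ = ∑ x, μ x • (Pi.single x.1 (Pi.single x.2.1 1) : Pts κ K) := by
  funext j x
  simp only [Finset.sum_apply, Pi.smul_apply, smul_eq_mul, extendZero]
  split_ifs with h
  · rw [Finset.sum_eq_single ⟨j, x, h⟩]
    · simp
    · rintro ⟨j', x', hx'⟩ - hne
      by_cases hj : j = j'
      · subst hj
        have : x ≠ x' := by
          rintro rfl
          exact hne rfl
        simp [this]
      · simp [Pi.single_eq_of_ne hj]
    · simp
  · symm
    refine Finset.sum_eq_zero ?_
    rintro ⟨j', x', hx'⟩ -
    by_cases hj : j = j'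
    · subst hj
      have : x ≠ x' := by
        rintro rfl
        exact h hx'
      simp [this]
    · simp [Pi.single_eq_of_ne hj]

theorem infAt_iff {L : Submodule K (Vec κ K)} {v : Pts κ K} {b : ∀ j, κ j}
    (hb : ∀ j, v j (b j) ≠ 0) (hv : tan v ≤ L) :
    InfAt v L ↔ ∀ u : Pts κ K, (∀ j, u j (b j) = 0) →
      (∀ j x, dseg (update v j (Pi.single x 1)) u ∈ L) → u = 0 := by
  constructor
  · intro h u hu hL
    funext j
    obtain ⟨t, ht⟩ := h u hL j
    have h0 := hu j
    rw [ht, Pi.smul_apply, smul_eq_mul, mul_eq_zero, or_iff_left (hb j)] at h0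
    rw [ht, h0, zero_smul, Pi.zero_apply]
  · intro h u hL j
    let t : ι → K := fun j => u j (b j) / v j (b j)
    have h0 : (fun j => u j - t j • v j) = 0 := by
      refine h _ (fun j => ?_) fun j x => ?_
      · simp only [Pi.sub_apply, Pi.smul_apply, smul_eq_mul, t]
        rw [div_mul_cancel₀ _ (hb j), sub_self]
      · have hsub : (fun j => u j - t j • v j) = u - fun j => t j • v j := rfl
        rw [hsub, map_sub]
        refine Submodule.sub_mem _ (hL j x) ?_
        rw [dseg_apply]
        refine Submodule.sum_mem _ fun i _ => ?_
        rw [MultilinearMap.map_update_smul]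
        refine Submodule.smul_mem _ _ (hv ?_)
        by_cases hij : i = j
        · subst hij
          rw [update_idem]
          exact seg_update_mem_tan _ _ _
        · rw [update_comm (Ne.symm hij), update_eq_self]
          exact seg_update_mem_tan _ _ _
    exact ⟨t j, sub_eq_zero.mp (congrFun h0 j)⟩

theorem linearIndependent_infFam_iff (hb : ∀ s j, p s j (b s j) ≠ 0)
    (hli : LinearIndependent K (frame p c b)) (s : S) :
    LinearIndependent K (infFam p c b s) ↔ InfAt (p s) (Lspan p c) := by
  rw [infAt_iff (hb s) (tan_le_Lspan p c s), Fintype.linearIndependent_iff]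
  have key : ∀ g : ((Σ j, κ j) × FIdx E b) ⊕ (Σ j, {x : κ j // x ≠ b s j}) → K,
      ∑ i, g i • infFam p c b s i = 0 ↔ ∀ z : Σ j, κ j,
        ∑ i, g (.inl (z, i)) • frame p c b i +
          dseg (update (p s) z.1 (Pi.single z.2 1)) (extendZero fun x => g (.inr x)) = 0 := by
    intro g
    have hval : ∀ z f, (∑ i, g i • infFam p c b s i) (z, f) =
        (∑ i, g (.inl (z, i)) • frame p c b i +
          dseg (update (p s) z.1 (Pi.single z.2 1)) (extendZero fun x => g (.inr x))) f := by
      intro z f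
      rw [extendZero_eq_sum, map_sum, Fintype.sum_sum_type]
      simp only [map_smul, Pi.add_apply, Finset.sum_apply, Pi.smul_apply, smul_eq_mul, infFam]
      congr 1
      rw [Fintype.sum_prod_type, Finset.sum_eq_single z]
      · simp
      · intro z' _ hz
        simp [hz]
      · simp
    constructor
    · intro h z
      funext f
      rw [← hval, h]
      rfl
    · intro h
      funext ⟨z, f⟩
      rw [hval, h]
      rfl
  constructor
  · intro h u hu hL
    have hmem : ∀ z : Σ j, κ j, ∃ γ : FIdx E b → K,
        ∑ i, γ i • frame p c b i = dseg (update (p s) z.1 (Pi.single z.2 1)) u := by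
      intro z
      have := hL z.1 z.2
      rw [← span_frame hb] at this
      exact (Submodule.mem_span_range_iff_exists_fun K).mp this
    choose γ hγ using hmem
    have hu' : (extendZero (b := b s) fun x => u x.1 x.2.1) = u := by
      funext j x
      by_cases hx : x = b s j
      · subst hx
        simp [extendZero, hu]
      · simp [extendZero, hx]
    have h0 := h (Sum.elim (fun i => -γ i.1 i.2) fun x => u x.1 x.2.1) ((key _).mpr fun z => by
      simp only [Sum.elim_inl, Sum.elim_inr, neg_smul, Finset.sum_neg_distrib]
      rw [hγ, hu', neg_add_cancel])
    rw [← hu']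
    funext j x
    by_cases hx : x = b s j
    · simp [extendZero, hx]
    · simpa [extendZero, hx] using h0 (.inr ⟨j, x, hx⟩)
  · intro h g hg
    have hg' := (key g).mp hg
    have hu := h (extendZero fun x => g (.inr x)) (fun j => by simp [extendZero]) fun j x => by
      have := hg' ⟨j, x⟩
      rw [add_comm, add_eq_zero_iff_eq_neg] at this
      rw [this, ← span_frame hb]
      exact Submodule.neg_mem _ (Submodule.sum_mem _ fun i _ =>
        Submodule.smul_mem _ _ (Submodule.subset_span ⟨i, rfl⟩))
    rintro (⟨z, i⟩ | ⟨j, x, hx⟩)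
    · have := hg' z
      rw [hu, map_zero, add_zero] at this
      exact Fintype.linearIndependent_iff.mp hli _ this i
    · simpa [extendZero, hx] using congrFun (congrFun hu j) x

end Field

/-- Goodness is an open condition. -/
theorem exists_good_locus [Nonempty ι] {R K₀ : Type} [CommRing R] [Field K₀] (p : S → Pts κ R)
    (c : E → Vec κ R) (b : S → ∀ j, κ j) (φ₀ : R →+* K₀)
    (hb : ∀ s j, φ₀ (p s j (b s j)) ≠ 0)
    (hgood : Good (fun s j x => φ₀ (p s j x)) fun i f => φ₀ (c i f)) :
    ∃ F : R, φ₀ F ≠ 0 ∧ ∀ (K : Type) [Field K] (φ : R →+* K), φ F ≠ 0 →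
      (∀ s j, φ (p s j (b s j)) ≠ 0) ∧
        Good (fun s j x => φ (p s j x)) fun i f => φ (c i f) := by
  have hli : LinearIndependent K₀
      (frame (fun s j x => φ₀ (p s j x)) (fun i f => φ₀ (c i f)) b) :=
    (linearIndependent_frame_iff (p := fun s j x => φ₀ (p s j x)) (b := b) hb).mpr hgood.1
  obtain ⟨F, hF, hF'⟩ := exists_minor (frame p c b) φ₀ (by
    simp only [frame_map]
    exact hli)
  have hinf : ∀ s, ∃ G : R, φ₀ G ≠ 0 ∧ ∀ (K : Type) [Field K] (φ : R →+* K), φ G ≠ 0 →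
      LinearIndependent K fun i y => φ (infFam p c b s i y) := fun s =>
    exists_minor (infFam p c b s) φ₀ (by
      simp only [infFam_map]
      exact (linearIndependent_infFam_iff (p := fun s j x => φ₀ (p s j x)) (b := b) hb hli s).mpr (hgood.2 s))
  choose G hG hG' using hinf
  refine ⟨(∏ s, ∏ j, p s j (b s j)) * (F * ∏ s, G s), ?_, fun K _ φ hφ => ?_⟩
  · simp only [map_mul, map_prod]
    exact mul_ne_zero (Finset.prod_ne_zero_iff.mpr fun s _ => Finset.prod_ne_zero_iff.mpr
      fun j _ => hb s j) (mul_ne_zero hF (Finset.prod_ne_zero_iff.mpr fun s _ => hG s))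
  · simp only [map_mul, map_prod, mul_ne_zero_iff, Finset.prod_ne_zero_iff, Finset.mem_univ,
      true_implies] at hφ
    obtain ⟨hb', hF0, hG0⟩ := hφ
    have hli' : LinearIndependent K
        (frame (fun s j x => φ (p s j x)) (fun i f => φ (c i f)) b) := by
      have := hF' K φ hF0
      simp only [frame_map] at this
      exact this
    refine ⟨hb', (linearIndependent_frame_iff (p := fun s j x => φ (p s j x)) (b := b) hb').mp hli', fun s => ?_⟩
    have := hG' s K φ (hG0 s)
    simp only [infFam_map] at this
    exact (linearIndependent_infFam_iff (p := fun s j x => φ (p s j x)) (b := b) hb' hli' s).mp this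

end Spread

section Generic

variable {ι : Type} [Fintype ι] [DecidableEq ι] {κ : ι → Type} [∀ i, Fintype (κ i)]
  [∀ i, DecidableEq (κ i)] {S E : Type} [Fintype S] [Fintype E]

/-- Indices of the coordinates of a configuration. -/
abbrev Coord (κ : ι → Type) (S E : Type) : Type := (S × Σ j, κ j) ⊕ (E × ∀ j, κ j)

/-- The points of a configuration with given coordinates. -/
def ptsOf {R : Type*} (θ : Coord κ S E → R) : S → Pts κ R := fun s j x => θ (.inl (s, ⟨j, x⟩))

/-- The extra vectors of a configuration with given coordinates. -/
def vecOf {R : Type*} (θ : Coord κ S E → R) : E → Vec κ R := fun i f => θ (.inr (i, f))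

theorem rich_of_algebraicIndependent {k K : Type*} [Field k] [CharZero k] [Field K] [Algebra k K]
    {θ : Coord κ S E → K} (hθ : AlgebraicIndependent k θ) : Rich k (ptsOf θ) (vecOf θ) := by
  intro δp δc
  obtain ⟨D, hD⟩ := exists_derivation_of_algebraicIndependent hθ
    (Sum.elim (fun x => δp x.1 x.2.1 x.2.2) fun y => δc y.1 y.2)
  refine ⟨D, fun s j => funext fun x => hD (.inl (s, ⟨j, x⟩)), fun i => funext fun f =>
    hD (.inr (i, f))⟩

/-- A further tangency point of a configuration. -/
def ExtraPoint {K : Type*} [Field K] (p : S → Pts κ K) (c : E → Vec κ K) (w : Pts κ K) : Prop :=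
  (∀ j, w j ≠ 0) ∧ tan w ≤ Lspan p c ∧ ∀ (s : S) (t : K), seg w ≠ t • seg (p s)

theorem not_extraPoint_of_algebraicIndependent {k K : Type*} [Field k] [CharZero k] [Field K]
    [Algebra k K] [Nonempty ι] [∀ j, Nontrivial (κ j)] {θ : Coord κ S E → K}
    (hθ : AlgebraicIndependent k θ) (hgood : Good (ptsOf θ) (vecOf θ))
    (hd : fullDim κ S E < Fintype.card (∀ j, κ j)) (w : Pts κ K) :
    ¬ ExtraPoint (ptsOf θ) (vecOf θ) w := by
  rintro ⟨hw, htan, hne⟩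
  have hrich := rich_of_algebraicIndependent hθ
  let b : ∀ j, κ j := fun j => Classical.arbitrary _
  have hb : ∀ s j, ptsOf θ s j (b j) ≠ 0 := fun s j => hrich.ne_zero s j (b j)
  have hL : Lspan (ptsOf θ) (vecOf θ) ≠ ⊤ := by
    intro h
    have := hgood.1
    rw [h, finrank_top, Module.finrank_fintype_fun_eq_card] at this
    exact hd.ne this.symm
  have hspan := seg_mem_span_of_tan_le hrich hL hgood.2 htan (htan (seg_mem_tan w))
  obtain ⟨s, t, h⟩ := exists_eq_smul_of_mem_span hb
    ((linearIndependent_frame_iff (b := fun _ => b) hb).mpr hgood.1) hw hspan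
  exact hne s t h

/-- Further tangency points at each member of a family of configurations give a further tangency
point of the induced configuration over any field under the ring of functions on the family. -/
theorem exists_extraPoint_map {Bad K Ω : Type*} [Field K] [Field Ω] (Φ : (Bad → K) →+* Ω)
    (p : S → Pts κ (Bad → K)) (c : E → Vec κ (Bad → K)) (b : S → ∀ j, κ j)
    (hb : ∀ θ s j, p s j (b s j) θ ≠ 0)
    (h : ∀ θ, ∃ w, ExtraPoint (fun s j x => p s j x θ) (fun i f => c i f θ) w) :
    ∃ w, ExtraPoint (fun s j x => Φ (p s j x)) (fun i f => Φ (c i f)) w := by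
  choose w hw htan hne using h
  let W : Pts κ (Bad → K) := fun j x θ => w θ j x
  let ev : ∀ θ : Bad, (Bad → K) →+* K := fun θ => Pi.evalRingHom (fun _ => K) θ
  refine ⟨fun j x => Φ (W j x), fun j => ?_, tan_le_iff.mpr fun j x => ?_, fun s t => ?_⟩
  · choose x hx using fun θ => Function.ne_iff.mp (hw θ j)
    have h1 : ∑ y, (fun θ => if y = x θ then (w θ j y)⁻¹ else 0) * W j y = 1 := by
      funext θ
      simp only [Finset.sum_apply, Pi.mul_apply, ite_mul, zero_mul, Finset.sum_ite_eq',
        Finset.mem_univ, if_true, Pi.one_apply, W]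
      exact inv_mul_cancel₀ (hx θ)
    intro h0
    have h2 := congrArg Φ h1
    simp only [map_sum, map_mul, map_one] at h2
    refine zero_ne_one (α := Ω) (h2 ▸ (Finset.sum_eq_zero fun y _ => ?_).symm)
    rw [show Φ (W j y) = 0 from congrFun h0 y, mul_zero]
  · choose τ β hτ using fun θ => mem_Lspan (tan_le_iff.mp (htan θ) j x)
    let T : S → Pts κ (Bad → K) := fun s j x θ => τ θ s j x
    let B : E → Bad → K := fun i θ => β θ i
    have h1 : seg (update W j (Pi.single x 1)) = ∑ s, dseg (p s) (T s) + ∑ i, B i • c i := by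
      funext f θ
      have h2 := congrFun (hτ θ) f
      have h3 : ev θ (seg (update W j (Pi.single x 1)) f) =
          ev θ ((∑ s, dseg (p s) (T s) + ∑ i, B i • c i) f) := by
        simp only [Pi.add_apply, Finset.sum_apply, map_add, map_sum, seg_map, dseg_map, map_update,
          map_single, Pi.smul_apply, smul_eq_mul, map_mul] at h2 ⊢
        exact h2
      exact h3
    have h4 : seg (update (fun j x => Φ (W j x)) j (Pi.single x 1)) =
        ∑ s, dseg (fun j x => Φ (p s j x)) (fun j x => Φ (T s j x)) +
          ∑ i, Φ (B i) • fun f => Φ (c i f) := by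
      funext f
      have h2 := congrArg Φ (congrFun h1 f)
      simp only [Pi.add_apply, Finset.sum_apply, map_add, map_sum, seg_map, dseg_map, map_update,
        map_single, Pi.smul_apply, smul_eq_mul, map_mul] at h2 ⊢
      exact h2
    rw [h4]
    refine Submodule.add_mem _ (Submodule.sum_mem _ fun s _ => ?_)
      (Submodule.sum_mem _ fun i _ => Submodule.smul_mem _ _ ?_)
    · exact tan_le_Lspan (fun s j x => Φ (p s j x)) _ s (dseg_mem_tan _ _)
    · exact mem_Lspan_right _ (fun i f => Φ (c i f)) i
  · have hex : ∀ θ, ∃ f, seg (w θ) f * seg (fun j x => p s j x θ) (b s) -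
        seg (w θ) (b s) * seg (fun j x => p s j x θ) f ≠ 0 := by
      intro θ
      by_contra! hall
      have h0 : seg (fun j x => p s j x θ) (b s) ≠ 0 := by
        rw [seg_apply]
        exact Finset.prod_ne_zero_iff.mpr fun j _ => hb θ s j
      refine hne θ s (seg (w θ) (b s) / seg (fun j x => p s j x θ) (b s)) (funext fun f => ?_)
      rw [Pi.smul_apply, smul_eq_mul, div_mul_eq_mul_div, eq_div_iff h0]
      exact sub_eq_zero.mp (hall f)
    choose f hf using hex
    let H : (∀ j, κ j) → Bad → K := fun g θ => if g = f θ then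
      (seg (w θ) g * seg (fun j x => p s j x θ) (b s) -
        seg (w θ) (b s) * seg (fun j x => p s j x θ) g)⁻¹ else 0
    have h1 : ∑ g, H g * (seg W g * seg (p s) (b s) - seg W (b s) * seg (p s) g) = 1 := by
      funext θ
      have h2 : ev θ (∑ g, H g * (seg W g * seg (p s) (b s) - seg W (b s) * seg (p s) g)) =
          ∑ g, (if g = f θ then
            (seg (w θ) g * seg (fun j x => p s j x θ) (b s) -
              seg (w θ) (b s) * seg (fun j x => p s j x θ) g)⁻¹ else 0) *
            (seg (w θ) g * seg (fun j x => p s j x θ) (b s) -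
              seg (w θ) (b s) * seg (fun j x => p s j x θ) g) := by
        simp only [map_sum, map_mul, map_sub, seg_map]
        rfl
      simp only [ite_mul, zero_mul, Finset.sum_ite_eq', Finset.mem_univ, if_true] at h2
      exact h2.trans (inv_mul_cancel₀ (hf θ))
    intro heq
    have h2 := congrArg Φ h1
    simp only [map_sum, map_mul, map_sub, seg_map, map_one] at h2
    rw [heq] at h2
    refine zero_ne_one (α := Ω) (h2 ▸ (Finset.sum_eq_zero fun g _ => ?_).symm)
    simp only [Pi.smul_apply, smul_eq_mul]
    ring

end Generic

section Field

/-- A set of points on which no nonzero polynomial vanishes carries a generic point. -/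
theorem exists_generic_point {K Z Bad : Type} [Field K] (x : Bad → Z → K)
    (h : ∀ F : MvPolynomial Z K, F ≠ 0 → ∃ i, MvPolynomial.eval (x i) F ≠ 0) :
    ∃ (Ω : Type) (_ : Field Ω) (_ : Algebra K Ω) (Φ : (Bad → K) →ₐ[K] Ω),
      AlgebraicIndependent K fun z => Φ fun i => x i z := by
  let ψ : MvPolynomial Z K →ₐ[K] (Bad → K) := MvPolynomial.aeval fun z i => x i z
  have hψ : ∀ F i, ψ F i = MvPolynomial.eval (x i) F := by
    intro F i
    have : (Pi.evalAlgHom K (fun _ : Bad => K) i).comp ψ = MvPolynomial.aeval (x i) := by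
      ext z
      simp [ψ]
    have h2 := congrArg (fun g => g F) this
    simpa [MvPolynomial.coe_aeval_eq_eval, MvPolynomial.aeval_eq_eval] using h2
  let N : Submonoid (Bad → K) := (nonZeroDivisors (MvPolynomial Z K)).map ψ
  obtain ⟨P, hP, -, hPN⟩ := Ideal.exists_le_prime_disjoint (⊥ : Ideal (Bad → K)) N (by
    rw [Set.disjoint_left]
    rintro _ h0 ⟨F, hF, rfl⟩
    obtain ⟨i, hi⟩ := h F (nonZeroDivisors.ne_zero hF)
    refine hi ?_
    rw [← hψ]
    exact congrFun (Ideal.mem_bot.mp h0) i)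
  let Φ : (Bad → K) →ₐ[K] FractionRing ((Bad → K) ⧸ P) :=
    (IsScalarTower.toAlgHom K ((Bad → K) ⧸ P) (FractionRing ((Bad → K) ⧸ P))).comp
      (Ideal.Quotient.mkₐ K P)
  refine ⟨FractionRing ((Bad → K) ⧸ P), inferInstance, inferInstance, Φ, ?_⟩
  rw [AlgebraicIndependent, injective_iff_map_eq_zero]
  intro F hF
  by_contra hne
  have hcomp : MvPolynomial.aeval (fun z => Φ fun i => x i z) = Φ.comp ψ := by
    ext z
    simp [ψ]
  rw [hcomp] at hF
  have h1 : Ideal.Quotient.mk P (ψ F) = 0 :=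
    IsFractionRing.injective ((Bad → K) ⧸ P) (FractionRing ((Bad → K) ⧸ P))
      (hF.trans (map_zero _).symm)
  exact Set.disjoint_left.mp hPN (Ideal.Quotient.eq_zero_iff_mem.mp h1)
    ⟨F, mem_nonZeroDivisors_of_ne_zero hne, rfl⟩

end Field

section Generic

variable {ι : Type} [Fintype ι] [DecidableEq ι] {κ : ι → Type} [∀ i, Fintype (κ i)]
  [∀ i, DecidableEq (κ i)] {S E : Type} [Fintype S] [Fintype E]

/-- The existence of a good configuration implies that general configurations have no further
tangency points. -/
theorem exists_generic_locus {K : Type} [Field K] [CharZero K] [Nonempty ι]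
    [∀ j, Nontrivial (κ j)] (θ₀ : Coord κ S E → K) (b : S → ∀ j, κ j)
    (hb : ∀ s j, ptsOf θ₀ s j (b s j) ≠ 0) (hgood : Good (ptsOf θ₀) (vecOf θ₀))
    (hd : fullDim κ S E < Fintype.card (∀ j, κ j)) :
    ∃ F : MvPolynomial (Coord κ S E) K, F ≠ 0 ∧ ∀ θ, MvPolynomial.eval θ F ≠ 0 →
      Module.finrank K (Lspan (ptsOf θ) (vecOf θ)) = fullDim κ S E ∧
        ∀ w, ¬ ExtraPoint (ptsOf θ) (vecOf θ) w := by
  obtain ⟨F₀, hF₀, hF₀'⟩ := exists_good_locus (R := MvPolynomial (Coord κ S E) K)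
    (ptsOf MvPolynomial.X) (vecOf MvPolynomial.X) b (MvPolynomial.eval θ₀)
    (by simpa [ptsOf] using hb) (by
      simp only [ptsOf, vecOf, MvPolynomial.eval_X]
      exact hgood)
  have hF₀ne : F₀ ≠ 0 := by
    rintro rfl
    exact hF₀ (map_zero _)
  have hgood' : ∀ θ, MvPolynomial.eval θ F₀ ≠ 0 →
      (∀ s j, ptsOf θ s j (b s j) ≠ 0) ∧ Good (ptsOf θ) (vecOf θ) := by
    intro θ hθ
    have := hF₀' K (MvPolynomial.eval θ) hθ
    simp only [ptsOf, vecOf, MvPolynomial.eval_X] at this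
    exact this
  by_contra! hcon
  let Bad : Type := {θ : Coord κ S E → K // MvPolynomial.eval θ F₀ ≠ 0 ∧
    ∃ w, ExtraPoint (ptsOf θ) (vecOf θ) w}
  obtain ⟨Ω, _, _, Φ, hΦ⟩ := exists_generic_point (fun θ : Bad => θ.1) (by
    intro F hF
    obtain ⟨θ, hθ, h⟩ := hcon (F₀ * F) (mul_ne_zero hF₀ne hF)
    rw [map_mul] at hθ
    have h0 := left_ne_zero_of_mul hθ
    exact ⟨⟨θ, h0, h (hgood' θ h0).2.1⟩, right_ne_zero_of_mul hθ⟩)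
  obtain ⟨w, hw⟩ := exists_extraPoint_map Φ.toRingHom
    (ptsOf fun z (θ : Bad) => θ.1 z) (vecOf fun z (θ : Bad) => θ.1 z) b
    (fun θ => (hgood' θ.1 θ.2.1).1) fun θ => θ.2.2
  refine not_extraPoint_of_algebraicIndependent hΦ ?_ hd w hw
  have h1 := (hF₀' Ω (MvPolynomial.aeval fun z => Φ fun θ : Bad => θ.1 z).toRingHom (by
    intro h0
    exact hF₀ne (hΦ (h0.trans (map_zero _).symm)))).2
  simp only [ptsOf, vecOf, AlgHom.toRingHom_eq_coe, RingHom.coe_coe, MvPolynomial.aeval_X] at h1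
  exact h1

end Generic

section Reindex

variable {ι : Type} [Fintype ι] [DecidableEq ι] {κ : ι → Type} [∀ i, Fintype (κ i)]
  [∀ i, DecidableEq (κ i)] {S E S' E' : Type} {k K : Type*} [Field k] [Field K] [Algebra k K]

theorem Lspan_reindex (p : S → Pts κ K) (c : E → Vec κ K) (e : S' ≃ S) (e' : E' ≃ E) :
    Lspan (p ∘ e) (c ∘ e') = Lspan p c := by
  rw [Lspan, Lspan, e'.surjective.range_comp]
  congr 1
  exact e.surjective.iSup_comp fun s => tan (p s)

theorem Rich.reindex {p : S → Pts κ K} {c : E → Vec κ K} (h : Rich k p c) (e : S' ≃ S)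
    (e' : E' ≃ E) : Rich k (p ∘ e) (c ∘ e') := by
  intro δp δc
  obtain ⟨D, h1, h2⟩ := h (δp ∘ e.symm) (δc ∘ e'.symm)
  exact ⟨D, fun s j => by simp [h1], fun i => by simp [h2]⟩

theorem good_reindex_iff [Fintype S] [Fintype E] [Fintype S'] [Fintype E'] {p : S → Pts κ K}
    {c : E → Vec κ K} (e : S' ≃ S) (e' : E' ≃ E) : Good (p ∘ e) (c ∘ e') ↔ Good p c := by
  have hf : fullDim κ S' E' = fullDim κ S E := by
    rw [fullDim, fullDim, Fintype.card_congr e, Fintype.card_congr e']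
  rw [Good, Good, Lspan_reindex, hf]
  exact and_congr_right fun _ => e.forall_congr_left.trans (by simp)

end Reindex

section Rich

variable {ι : Type} [Fintype ι] [DecidableEq ι] {κ : ι → Type} [∀ i, Fintype (κ i)]
  [∀ i, DecidableEq (κ i)] {S E : Type} [Fintype S] [Fintype E]

/-- `F` cuts out configurations of wrong dimension or with further tangency points. -/
def Excludes (F : MvPolynomial (Coord κ S E) ℂ) : Prop :=
  ∀ θ, MvPolynomial.eval θ F ≠ 0 →
    Module.finrank ℂ (Lspan (ptsOf θ) (vecOf θ)) = fullDim κ S E ∧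
      ∀ w, ¬ ExtraPoint (ptsOf θ) (vecOf θ) w

theorem Excludes.good_of_rich {F : MvPolynomial (Coord κ S E) ℂ} (h : Excludes F) (hF : F ≠ 0)
    {k : Subfield ℂ} (hk : ∀ m, F.coeff m ∈ k) (f : ∀ j, κ j) {p : S → Pts κ ℂ}
    {c : E → Vec κ ℂ} (hr : Rich k p c) : Good p c := by
  classical
  let θ : Coord κ S E → ℂ := Sum.elim (fun x => p x.1 x.2.1 x.2.2) fun y => c y.1 y.2
  have hD : ∀ i : Coord κ S E, ∃ D : Derivation k ℂ ℂ, ∀ j, D (θ j) = if i = j then 1 else 0 := by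
    intro i
    obtain ⟨D, h1, h2⟩ := hr (ptsOf fun j => if i = j then 1 else 0)
      (vecOf fun j => if i = j then 1 else 0)
    refine ⟨D, ?_⟩
    rintro (⟨s, j, x⟩ | ⟨e, g⟩)
    · exact congrFun (h1 s j) x
    · exact congrFun (h2 e) g
  choose D hD using hD
  have hne : MvPolynomial.eval θ F ≠ 0 := fun h0 =>
    hF (eq_zero_of_eval_eq_zero_of_derivation D θ hD F
      (fun i m => (D i).map_algebraMap ⟨F.coeff m, hk m⟩) h0)
  obtain ⟨h1, h2⟩ := h θ hne
  refine ⟨h1, infAt_of_unique hr (fun w hw htan => ?_) f⟩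
  by_contra! hcon
  exact h2 w ⟨hw, htan, hcon⟩

theorem exists_countable_subfield {Z : Type} (F : MvPolynomial Z ℂ) :
    ∃ k : Subfield ℂ, Countable k ∧ ∀ m, F.coeff m ∈ k := by
  refine ⟨Subfield.closure (F.coeffs : Set ℂ), ?_, fun m => ?_⟩
  · rw [← Cardinal.mk_le_aleph0_iff]
    refine (Subfield.cardinalMk_closure_le_max _).trans (max_le ?_ le_rfl)
    exact (F.coeffs.countable_toSet).le_aleph0
  · by_cases h : F.coeff m = 0
    · rw [h]
      exact zero_mem _
    · exact Subfield.subset_closure (MvPolynomial.coeff_mem_coeffs m h)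

end Rich

section Induction

variable {q : ℕ} {κ : Fin (q + 1) → Type} [∀ i, Fintype (κ i)] [∀ i, DecidableEq (κ i)]
  {T G E S' E' : Type} [Fintype T] [DecidableEq T] [Fintype G] [DecidableEq G] [Fintype E]
  [Fintype S'] [Fintype E']

/-- Excluding polynomials exist after adding a factor. -/
theorem exists_excludes_succ [NeZero q] [∀ j, Nontrivial (κ j)]
    (eE : ∀ i : Last κ, E ≃ SIdx T G i) (eS : S' ≃ Last κ × T) (eE' : E' ≃ Last κ × G)
    (hd : fullDim (Ini κ) T E < Fintype.card (∀ j, Ini κ j))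
    {F : MvPolynomial (Coord (Ini κ) T E) ℂ} (hF : F ≠ 0) (h : Excludes F) :
    ∃ F' : MvPolynomial (Coord κ S' E') ℂ, F' ≠ 0 ∧ Excludes F' := by
  obtain ⟨k, hk, hcoeff⟩ := exists_countable_subfield F
  let f : ∀ j, Ini κ j := fun j => Classical.arbitrary _
  obtain ⟨θ, hθ⟩ := exists_algebraicIndependent_of_countable k hk
    (Coord (Ini κ) (Last κ × T) (Last κ × ((Last κ × T) ⊕ G)))
  have hrich := rich_of_algebraicIndependent hθ
  have hfull : ∀ i : Last κ, fullDim (Ini κ) T (SIdx T G i) = fullDim (Ini κ) T E := fun i => by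
    rw [fullDim, fullDim, Fintype.card_congr (eE i)]
  let x := ptsOf θ
  let c : Last κ → (Last κ × T) ⊕ G → Vec (Ini κ) ℂ := fun i y => vecOf θ (i, y)
  have hgood : Good (specialPts x) (specialVec c) := by
    refine good_special (k := k) f (fun i => (hfull i).trans_lt hd) (fun i p c hr => ?_) hrich
    exact (good_reindex_iff (Equiv.refl T) (eE i)).mp
      (h.good_of_rich hF hcoeff f (hr.reindex (Equiv.refl T) (eE i)))
  have hgood' := (good_reindex_iff eS eE').mpr hgood
  let θ₀ : Coord κ S' E' → ℂ := Sum.elim (fun y => specialPts x (eS y.1) y.2.1 y.2.2)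
    fun y => specialVec c (eE' y.1) y.2
  refine exists_generic_locus θ₀ (fun s => consIdx (eS s).1 f) (fun s j => ?_) hgood' ?_
  · change specialPts x (eS s) j (consIdx (eS s).1 f j) ≠ 0
    rw [specialPts]
    refine Fin.lastCases ?_ (fun j => ?_) j
    · rw [cons_last, consIdx_last]
      simp
    · rw [cons_castSucc, consIdx_castSucc]
      exact hrich.ne_zero _ _ _
  · have h1 : fullDim κ S' E' = fullDim κ (Last κ × T) (Last κ × G) := by
      rw [fullDim, fullDim, Fintype.card_congr eS, Fintype.card_congr eE']
    rw [h1, fullDim_special, Fintype.card_pi, Fin.prod_univ_castSucc, mul_comm]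
    rw [Finset.sum_congr rfl fun i _ => hfull i, Finset.sum_const, Finset.card_univ, smul_eq_mul]
    rw [Fintype.card_pi] at hd
    exact Nat.mul_lt_mul_of_pos_left hd Fintype.card_pos

end Induction

section Tensors

variable {q : ℕ} (a : Fin q → ℕ)

/-- Coordinates of tensors. -/
def coords : Ten q a ≃ₗ[ℂ] Vec (fun j => Fin (a j + 1)) ℂ :=
  (Basis.piTensorProduct fun j => Pi.basisFun ℂ (Fin (a j + 1))).equivFun

theorem coords_tprod (v : Pts (fun j => Fin (a j + 1)) ℂ) :
    coords a (tprod ℂ v) = seg v := by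
  funext f
  rw [coords, Module.Basis.equivFun_apply, Basis.piTensorProduct_repr_tprod_apply, seg_apply]
  simp

theorem coords_fromCoords (c : BIdx q a → ℂ) : coords a (fromCoords a c) = c := by
  rw [fromCoords, map_sum]
  simp only [map_smul, basisVec, coords_tprod, seg_single]
  exact (pi_eq_sum_univ' c).symm

theorem map_coords_tangent (v : Pts (fun j => Fin (a j + 1)) ℂ) :
    (tangent a v).map (coords a).toLinearMap = tan v := by
  rw [tangent, Submodule.map_span]
  apply le_antisymm
  · rw [Submodule.span_le]
    rintro _ ⟨_, ⟨j, u, rfl⟩, rfl⟩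
    exact (coords_tprod a _).symm ▸ seg_update_mem_tan v j u
  · exact tan_le_iff.mpr fun j b => Submodule.subset_span
      ⟨_, ⟨j, Pi.single b 1, rfl⟩, coords_tprod a _⟩

theorem map_coords_sup {k e : ℕ} (p : Fin k → Pts (fun j => Fin (a j + 1)) ℂ)
    (c : Fin e → BIdx q a → ℂ) :
    ((⨆ i, tangent a (p i)) ⊔
      Submodule.span ℂ (Set.range fun m => fromCoords a (c m))).map (coords a).toLinearMap =
      Lspan p c := by
  rw [Submodule.map_sup, Submodule.map_iSup, Submodule.map_span, ← Set.range_comp, Lspan]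
  simp only [map_coords_tangent]
  congr 3
  funext m
  exact coords_fromCoords a (c m)

theorem evalWV_ptsOf_vecOf {k e : ℕ} (F : MvPolynomial (WIdx q a k ⊕ (Fin e × BIdx q a)) ℂ)
    (θ : WIdx q a k ⊕ (Fin e × BIdx q a) → ℂ) :
    evalWV F (ptsOf (κ := fun j => Fin (a j + 1)) θ) (vecOf θ) = MvPolynomial.eval θ F :=
  congrArg (fun η => MvPolynomial.eval η F) (Sum.elim_comp_inl_inr θ)

theorem tangentGeneral_iff {k d : ℕ} (hd : k * (1 + ∑ j, a j) ≤ d) :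
    TangentGeneral q a k d ↔ ∃ F : MvPolynomial (Coord (fun j => Fin (a j + 1)) (Fin k)
      (Fin (d - k * (1 + ∑ j, a j)))) ℂ, F ≠ 0 ∧ Excludes F := by
  have hfull : fullDim (fun j => Fin (a j + 1)) (Fin k) (Fin (d - k * (1 + ∑ j, a j))) = d := by
    simp [fullDim, Nat.add_sub_cancel' hd]
  have key : ∀ (p : Fin k → Pts (fun j => Fin (a j + 1)) ℂ)
      (c : Fin (d - k * (1 + ∑ j, a j)) → BIdx q a → ℂ),
      (Module.finrank ℂ
          ↥((⨆ i, tangent a (p i)) ⊔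
            Submodule.span ℂ (Set.range fun m => fromCoords a (c m))) = d ∧
       ∀ w : ∀ j : Fin q, Fin (a j + 1) → ℂ, (∀ j, w j ≠ 0) →
         tangent a w ≤
           (⨆ i, tangent a (p i)) ⊔
             Submodule.span ℂ (Set.range fun m => fromCoords a (c m)) →
         ∃ (i : Fin k) (t : ℂ), tprod ℂ w = t • tprod ℂ (p i)) ↔
      (Module.finrank ℂ (Lspan p c) =
        fullDim (fun j => Fin (a j + 1)) (Fin k) (Fin (d - k * (1 + ∑ j, a j))) ∧
        ∀ w, ¬ ExtraPoint p c w) := by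
    intro p c
    rw [hfull, ← map_coords_sup, LinearEquiv.finrank_map_eq]
    refine and_congr_right fun _ => forall_congr' fun w => ?_
    have h1 : tangent a w ≤ (⨆ i, tangent a (p i)) ⊔
        Submodule.span ℂ (Set.range fun m => fromCoords a (c m)) ↔ tan w ≤ Lspan p c := by
      rw [← map_coords_sup, ← map_coords_tangent,
        Submodule.map_le_map_iff_of_injective (coords a).injective]
    have h2 : ∀ i (t : ℂ), tprod ℂ w = t • tprod ℂ (p i) ↔ seg w = t • seg (p i) := by
      intro i t
      rw [← coords_tprod, ← coords_tprod, ← (coords a).map_smul, (coords a).injective.eq_iff]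
    rw [h1]
    simp only [h2, ExtraPoint]
    push Not
    rfl
  constructor
  · rintro ⟨F, ⟨p, c, hF⟩, h⟩
    refine ⟨F, fun h0 => hF ?_, fun θ hθ => (key _ _).mp (h (ptsOf θ) (vecOf θ) ?_)⟩
    · rw [h0, evalWV, map_zero]
    · rwa [evalWV_ptsOf_vecOf]
  · rintro ⟨F, hF, h⟩
    refine ⟨F, ?_, fun p c hpc => (key p c).mpr
      (h (Sum.elim (fun x => p x.1 x.2.1 x.2.2) fun y => c y.1 y.2) hpc)⟩
    by_contra! hcon
    refine hF (MvPolynomial.funext fun θ => ?_)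
    rw [map_zero, ← hcon (ptsOf θ) (vecOf θ), evalWV_ptsOf_vecOf]

theorem tangentGeneral_succ (hq : 0 < q) (a : Fin (q + 1) → ℕ) (ha : ∀ j, 0 < a j) (k r : ℕ)
    (h2 : r + 1 < ∏ i : Fin q, (a i.castSucc + 1))
    (h3 : ((∑ i : Fin q, a i.castSucc) + a (Fin.last q) + 1) * k ≤ r + 1)
    (hX : TangentGeneral q (fun j => a j.castSucc) k (r + 1)) :
    TangentGeneral (q + 1) a ((a (Fin.last q) + 1) * k) ((a (Fin.last q) + 1) * (r + 1)) := by
  have : NeZero q := ⟨hq.ne'⟩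
  have hnt : ∀ j, Nontrivial (Fin (a j + 1)) := fun j =>
    Fin.nontrivial_iff_two_le.mpr (Nat.succ_le_succ (ha j))
  set n := ∑ i : Fin q, a i.castSucc with hn
  set m := a (Fin.last q) with hm
  obtain ⟨g, hg⟩ := Nat.exists_eq_add_of_le h3
  have hd1 : k * (1 + ∑ j : Fin q, a j.castSucc) ≤ r + 1 := by rw [← hn]; nlinarith
  have he : r + 1 - k * (1 + ∑ j : Fin q, a j.castSucc) = m * k + g := by
    rw [← hn, hg]
    refine Nat.sub_eq_of_eq_add ?_
    ring
  have hd2 : (m + 1) * k * (1 + ∑ j, a j) ≤ (m + 1) * (r + 1) := by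
    rw [Fin.sum_univ_castSucc, ← hn, ← hm, hg]
    nlinarith [Nat.zero_le ((m + 1) * g)]
  have he' : (m + 1) * (r + 1) - (m + 1) * k * (1 + ∑ j, a j) = (m + 1) * g := by
    rw [Fin.sum_univ_castSucc, ← hn, ← hm, hg]
    refine Nat.sub_eq_of_eq_add ?_
    ring
  obtain ⟨F, hF, hE⟩ := (tangentGeneral_iff _ hd1).mp hX
  refine (tangentGeneral_iff _ hd2).mpr ?_
  refine exists_excludes_succ (κ := fun j => Fin (a j + 1)) (T := Fin k) (G := Fin g)
    (fun i => Fintype.equivOfCardEq ?_) (Fintype.equivOfCardEq ?_) (Fintype.equivOfCardEq ?_)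
    ?_ hF hE
  · simp [he, Fintype.card_subtype_compl, ← hm]
  · simp [← hm]
  · simp [he', ← hm]
  · simp only [fullDim, Fintype.card_fin, Fintype.card_pi, Nat.add_sub_cancel]
    rw [Nat.add_sub_cancel' hd1]
    exact h2

end Tensors

end Segre

/-- Main Lemma, Segre form. -/
theorem stmt_1 (q : ℕ) (hq : 2 ≤ q) (a : Fin q → ℕ) (ha : ∀ i, 0 < a i)
    (m : ℕ) (hm : 0 < m) (k r : ℕ) (hk : 0 < k) (hr : 0 < r)
    (h1 : ((∑ i, a i) + 1) * k < ∏ i, (a i + 1))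
    (h2 : r + 1 < ∏ i, (a i + 1))
    (h3 : ((∑ i, a i) + m + 1) * k ≤ r + 1)
    (hX : TangentGeneral q a k (r + 1)) :
    TangentGeneral (q + 1) (Fin.snoc a m) ((m + 1) * k) ((m + 1) * (r + 1)) := by
  have hcs : ∀ j : Fin q, (Fin.snoc a m : Fin (q + 1) → ℕ) j.castSucc = a j := fun j =>
    Fin.snoc_castSucc (α := fun _ => ℕ) _ _ _
  have hla : (Fin.snoc a m : Fin (q + 1) → ℕ) (Fin.last q) = m :=
    Fin.snoc_last (α := fun _ => ℕ) _ _
  have h := Segre.tangentGeneral_succ (by lia) (Fin.snoc a m)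
    (Fin.lastCases (by rw [hla]; exact hm) fun j => by rw [hcs]; exact ha j) k r
  simp only [hcs, hla] at h
  exact h h2 h3 hX
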